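/- arXiv:quant-ph/0008047 — 2 statements merged into one kernel-verified Lean document; each statement's English description precedes it below -/
import Mathlib

section
/- Define B(ρ,σ) := S(ρ||σ) + log₂ Tr|σ^Γ| for states ρ, σ on the same bipartite system with the support of ρ contained in the support of σ. Then: (i) for any trace-preserving linear map Ψ between bipartite matrix spaces such that both Ψ and Ψ^Γ : A ↦ Ψ(A^Γ)^Γ are positive, B(Ψ(ρ), Ψ(σ)) ≤ B(ρ,σ); (ii) B is convex in its first argument: for any further state ρ' with support contained in the support of σ and any 0 < p < 1, B(pρ + (1−p)ρ', σ) ≤ p·B(ρ,σ) + (1−p)·B(ρ',σ); (iii) B is additive under tensor products: B(ρ ⊗ ρ', σ ⊗ σ') = B(ρ,σ) + B(ρ',σ'), where tensor products of bipartite states are regarded as bipartite by grouping the two first factors against the two second factors. -/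
open Matrix Filter
open scoped ComplexOrder

noncomputable section

/-- Partial transpose on the second tensor factor:
`ptrans M ((i,j),(k,l)) = M ((i,l),(k,j))`. -/
def ptrans {ι κ : Type*} (M : Matrix (ι × κ) (ι × κ) ℂ) : Matrix (ι × κ) (ι × κ) ℂ :=
  fun x y => M (x.1, y.2) (y.1, x.2)

/-- Fidelity of `K`-state p.p.t. distillation:
the supremum of `Tr(Fρ)` over Hermitian `F` with `0 ≤ F ≤ 1` and `-1/K ≤ F^Γ ≤ 1/K`. -/
def FGamma {ι κ : Type*} [Fintype ι] [Fintype κ] [DecidableEq ι] [DecidableEq κ]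
    (ρ : Matrix (ι × κ) (ι × κ) ℂ) (K : ℝ) : ℝ :=
  sSup {x : ℝ | ∃ F : Matrix (ι × κ) (ι × κ) ℂ,
    F.PosSemidef ∧ (1 - F).PosSemidef ∧
    (((1 / K : ℝ) : ℂ) • 1 - ptrans F).PosSemidef ∧
    (ptrans F + ((1 / K : ℝ) : ℂ) • 1).PosSemidef ∧
    x = ((F * ρ).trace).re}

/-- Trace of the positive part of a Hermitian matrix: `Tr(A₊) = ∑ᵢ max(λᵢ, 0)`. -/
def tracePos {n : Type*} [Fintype n] [DecidableEq n] (A : Matrix n n ℂ) : ℝ :=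
  if h : A.IsHermitian then ∑ i, max (h.eigenvalues i) 0 else 0

/-- Trace norm of a Hermitian matrix: `Tr|A| = ∑ᵢ |λᵢ|`. -/
def traceAbs {n : Type*} [Fintype n] [DecidableEq n] (A : Matrix n n ℂ) : ℝ :=
  if h : A.IsHermitian then ∑ i, |h.eigenvalues i| else 0

/-- Base-2 logarithm of a Hermitian matrix via the spectral theorem
(with the convention `log 0 = 0` on the kernel, and junk value `0` otherwise). -/
def hermLog2 {n : Type*} [Fintype n] [DecidableEq n] (A : Matrix n n ℂ) : Matrix n n ℂ :=
  if h : A.IsHermitian then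
    (h.eigenvectorUnitary : Matrix n n ℂ) *
      Matrix.diagonal (fun i => ((Real.logb 2 (h.eigenvalues i) : ℝ) : ℂ)) *
      star (h.eigenvectorUnitary : Matrix n n ℂ)
  else 0

/-- Relative entropy `S(ρ‖σ) = Tr(ρ (log₂ ρ - log₂ σ))`. -/
def relEnt {n : Type*} [Fintype n] [DecidableEq n] (ρ σ : Matrix n n ℂ) : ℝ :=
  ((ρ * (hermLog2 ρ - hermLog2 σ)).trace).re

/-- Tensor product of two bipartite matrices, regrouped as a bipartite matrix
(first factors against second factors). -/
def tensorBip {ι₁ κ₁ ι₂ κ₂ : Type*}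
    (ρ₁ : Matrix (ι₁ × κ₁) (ι₁ × κ₁) ℂ) (ρ₂ : Matrix (ι₂ × κ₂) (ι₂ × κ₂) ℂ) :
    Matrix ((ι₁ × ι₂) × (κ₁ × κ₂)) ((ι₁ × ι₂) × (κ₁ × κ₂)) ℂ :=
  fun x y => ρ₁ (x.1.1, x.2.1) (y.1.1, y.2.1) * ρ₂ (x.1.2, x.2.2) (y.1.2, y.2.2)

lemma conj_diag_nonneg {n : Type*} [Fintype n] {A : Matrix n n ℂ} (hA : A.PosSemidef) (U : Matrix n n ℂ) (i : n) :
    0 ≤ ((Uᴴ * A * U) i i).re :=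
  (Complex.nonneg_iff.mp (hA.conjTranspose_mul_mul_same U).diag_nonneg).1

section Diagonalization

variable {n : Type*} [Fintype n] [DecidableEq n]

/-- The matrix `U diag(d) Uᴴ` for a real vector `d`. -/
def conjDiag (U : Matrix n n ℂ) (d : n → ℝ) : Matrix n n ℂ :=
  U * diagonal (fun i => ((d i : ℝ) : ℂ)) * Uᴴ

lemma conjDiag_isHermitian (U : Matrix n n ℂ) (d : n → ℝ) : (conjDiag U d).IsHermitian := by
  unfold conjDiag Matrix.IsHermitian
  rw [conjTranspose_mul, conjTranspose_mul, conjTranspose_conjTranspose,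
    diagonal_conjTranspose, Matrix.mul_assoc]
  congr 3
  ext i
  simp

lemma eigenvectorUnitary_conjTranspose_mul {A : Matrix n n ℂ} (h : A.IsHermitian) :
    (h.eigenvectorUnitary : Matrix n n ℂ)ᴴ * (h.eigenvectorUnitary : Matrix n n ℂ) = 1 :=
  Unitary.coe_star_mul_self h.eigenvectorUnitary

lemma eq_conjDiag_eigenvalues {A : Matrix n n ℂ} (h : A.IsHermitian) :
    A = conjDiag (h.eigenvectorUnitary : Matrix n n ℂ) h.eigenvalues := by
  conv_lhs => rw [h.spectral_theorem]
  rfl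

lemma exists_eq_conjDiag {A : Matrix n n ℂ} (h : A.IsHermitian) :
    ∃ (U : Matrix n n ℂ) (d : n → ℝ), Uᴴ * U = 1 ∧ A = conjDiag U d :=
  ⟨_, _, eigenvectorUnitary_conjTranspose_mul h, eq_conjDiag_eigenvalues h⟩

lemma conjTranspose_conjDiag_mul {U : Matrix n n ℂ} (hU : Uᴴ * U = 1) (d : n → ℝ) :
    Uᴴ * conjDiag U d * U = diagonal (fun i => ((d i : ℝ) : ℂ)) := by
  unfold conjDiag
  rw [show Uᴴ * (U * diagonal (fun i => ((d i : ℝ) : ℂ)) * Uᴴ) * U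
      = (Uᴴ * U) * diagonal (fun i => ((d i : ℝ) : ℂ)) * (Uᴴ * U) by
    simp only [Matrix.mul_assoc], hU, Matrix.one_mul, Matrix.mul_one]

lemma conjDiag_comp_eq {U V : Matrix n n ℂ} {d d' : n → ℝ} (hU : Uᴴ * U = 1) (hV : Vᴴ * V = 1)
    (h : conjDiag U d = conjDiag V d') (f : ℝ → ℝ) :
    conjDiag U (fun i => f (d i)) = conjDiag V (fun i => f (d' i)) := by
  have hU' : U * Uᴴ = 1 := mul_eq_one_comm.mp hU
  have hV' : V * Vᴴ = 1 := mul_eq_one_comm.mp hV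
  have key : (Vᴴ * U) * diagonal (fun i => ((d i : ℝ) : ℂ)) =
      diagonal (fun i => ((d' i : ℝ) : ℂ)) * (Vᴴ * U) := by
    calc (Vᴴ * U) * diagonal (fun i => ((d i : ℝ) : ℂ))
        = Vᴴ * conjDiag U d * U := by
          unfold conjDiag
          simp only [Matrix.mul_assoc, hU, Matrix.mul_one]
      _ = Vᴴ * conjDiag V d' * U := by rw [h]
      _ = (Vᴴ * V) * (diagonal (fun i => ((d' i : ℝ) : ℂ)) * (Vᴴ * U)) := by
          unfold conjDiag
          simp only [Matrix.mul_assoc]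
      _ = _ := by rw [hV, Matrix.one_mul]
  have key2 : (Vᴴ * U) * diagonal (fun i => ((f (d i) : ℝ) : ℂ)) =
      diagonal (fun i => ((f (d' i) : ℝ) : ℂ)) * (Vᴴ * U) := by
    ext i j
    have hij := congrFun (congrFun key i) j
    rw [mul_diagonal, diagonal_mul] at hij ⊢
    by_cases h0 : (Vᴴ * U) i j = 0
    · simp [h0]
    · have : ((d j : ℝ) : ℂ) = ((d' i : ℝ) : ℂ) := by
        rw [mul_comm] at hij
        exact mul_right_cancel₀ h0 hij
      rw [Complex.ofReal_inj.mp this, mul_comm]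
  calc conjDiag U (fun i => f (d i))
      = (V * Vᴴ) * (U * diagonal (fun i => ((f (d i) : ℝ) : ℂ)) * Uᴴ) := by
        rw [hV', Matrix.one_mul]; rfl
    _ = V * ((Vᴴ * U) * diagonal (fun i => ((f (d i) : ℝ) : ℂ))) * Uᴴ := by
        simp only [Matrix.mul_assoc]
    _ = V * diagonal (fun i => ((f (d' i) : ℝ) : ℂ)) * Vᴴ * (U * Uᴴ) := by
        rw [key2]; simp only [Matrix.mul_assoc]
    _ = _ := by rw [hU', Matrix.mul_one]; rfl

lemma trace_mul_conjDiag (A U : Matrix n n ℂ) (d : n → ℝ) :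
    (A * conjDiag U d).trace = ∑ i, ((d i : ℝ) : ℂ) * (Uᴴ * A * U) i i := by
  unfold conjDiag
  rw [← Matrix.mul_assoc, ← Matrix.mul_assoc, trace_mul_comm, ← Matrix.mul_assoc,
    ← Matrix.mul_assoc]
  simp [Matrix.trace, mul_diagonal, mul_comm]

lemma trace_conjDiag {U : Matrix n n ℂ} (hU : Uᴴ * U = 1) (d : n → ℝ) :
    (conjDiag U d).trace = ((∑ i, d i : ℝ) : ℂ) := by
  have := trace_mul_conjDiag 1 U d
  rw [Matrix.one_mul, Matrix.mul_one, hU] at this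
  simpa using this

lemma sum_comp_eq {U V : Matrix n n ℂ} {d d' : n → ℝ} (hU : Uᴴ * U = 1) (hV : Vᴴ * V = 1)
    (h : conjDiag U d = conjDiag V d') (f : ℝ → ℝ) :
    ∑ i, f (d i) = ∑ i, f (d' i) := by
  have := congrArg Matrix.trace (conjDiag_comp_eq hU hV h f)
  rw [trace_conjDiag hU, trace_conjDiag hV] at this
  exact Complex.ofReal_inj.mp this

lemma hermLog2_conjDiag {U : Matrix n n ℂ} (hU : Uᴴ * U = 1) (d : n → ℝ) :
    hermLog2 (conjDiag U d) = conjDiag U (fun i => Real.logb 2 (d i)) := by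
  have h := conjDiag_isHermitian U d
  rw [hermLog2, dif_pos h]
  exact (conjDiag_comp_eq hU (eigenvectorUnitary_conjTranspose_mul h)
    (eq_conjDiag_eigenvalues h) (Real.logb 2)).symm

lemma traceAbs_conjDiag {U : Matrix n n ℂ} (hU : Uᴴ * U = 1) (d : n → ℝ) :
    traceAbs (conjDiag U d) = ∑ i, |d i| := by
  have h := conjDiag_isHermitian U d
  rw [traceAbs, dif_pos h]
  exact (sum_comp_eq hU (eigenvectorUnitary_conjTranspose_mul h)
    (eq_conjDiag_eigenvalues h) (fun x => |x|)).symm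

/-- Trace of the negative part of a Hermitian matrix. -/
def traceNeg (A : Matrix n n ℂ) : ℝ :=
  if h : A.IsHermitian then ∑ i, max (-h.eigenvalues i) 0 else 0

lemma traceNeg_conjDiag {U : Matrix n n ℂ} (hU : Uᴴ * U = 1) (d : n → ℝ) :
    traceNeg (conjDiag U d) = ∑ i, max (-d i) 0 := by
  have h := conjDiag_isHermitian U d
  rw [traceNeg, dif_pos h]
  exact (sum_comp_eq hU (eigenvectorUnitary_conjTranspose_mul h)
    (eq_conjDiag_eigenvalues h) (fun x => max (-x) 0)).symm

lemma conjDiag_posSemidef (U : Matrix n n ℂ) {d : n → ℝ} (hd : ∀ i, 0 ≤ d i) :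
    (conjDiag U d).PosSemidef :=
  (PosSemidef.diagonal (d := fun i => ((d i : ℝ) : ℂ))
    (fun i => by simpa using hd i)).mul_mul_conjTranspose_same U

lemma exists_eq_conjDiag_of_posSemidef {A : Matrix n n ℂ} (h : A.PosSemidef) :
    ∃ (U : Matrix n n ℂ) (d : n → ℝ), Uᴴ * U = 1 ∧ (∀ i, 0 ≤ d i) ∧ A = conjDiag U d :=
  ⟨_, _, eigenvectorUnitary_conjTranspose_mul h.1, h.eigenvalues_nonneg,
    eq_conjDiag_eigenvalues h.1⟩

lemma conjDiag_sub (U : Matrix n n ℂ) (d d' : n → ℝ) :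
    conjDiag U d - conjDiag U d' = conjDiag U (fun i => d i - d' i) := by
  unfold conjDiag
  rw [← Matrix.sub_mul, ← Matrix.mul_sub, diagonal_sub]
  simp

lemma conjDiag_add (U : Matrix n n ℂ) (d d' : n → ℝ) :
    conjDiag U d + conjDiag U d' = conjDiag U (fun i => d i + d' i) := by
  unfold conjDiag
  rw [← Matrix.add_mul, ← Matrix.mul_add, diagonal_add]
  simp

lemma conjDiag_const {U : Matrix n n ℂ} (hU : Uᴴ * U = 1) (r : ℝ) :
    conjDiag U (fun _ => r) = (r : ℂ) • 1 := by
  unfold conjDiag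
  rw [show diagonal (fun _ : n => (r : ℂ)) = (r : ℂ) • (1 : Matrix n n ℂ) by
    ext i j; simp [diagonal_apply, one_apply]]
  rw [Matrix.mul_smul, Matrix.smul_mul, Matrix.mul_one, mul_eq_one_comm.mp hU]

lemma conjDiag_add_smul_one {U : Matrix n n ℂ} (hU : Uᴴ * U = 1) (d : n → ℝ) (r : ℝ) :
    conjDiag U d + (r : ℂ) • 1 = conjDiag U (fun i => d i + r) := by
  rw [← conjDiag_const hU, conjDiag_add]

lemma trace_conj_eq {U : Matrix n n ℂ} (hU : Uᴴ * U = 1) (A : Matrix n n ℂ) :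
    ∑ i, ((Uᴴ * A * U) i i).re = A.trace.re := by
  have : A.trace = (Uᴴ * A * U).trace := by
    rw [trace_mul_comm, ← Matrix.mul_assoc, mul_eq_one_comm.mp hU, Matrix.one_mul]
  rw [this]
  simp [Matrix.trace]

lemma conjDiag_diag_eq {U : Matrix n n ℂ} (hU : Uᴴ * U = 1) {d : n → ℝ} {P Q : Matrix n n ℂ}
    (h : conjDiag U d = P - Q) (i : n) :
    d i = ((Uᴴ * P * U) i i).re - ((Uᴴ * Q * U) i i).re := by
  have := conjTranspose_conjDiag_mul hU d
  rw [h, Matrix.mul_sub, Matrix.sub_mul] at this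
  have := congrFun (congrFun this i) i
  rw [diagonal_apply_eq, Matrix.sub_apply] at this
  rw [← Complex.sub_re, this, Complex.ofReal_re]

lemma traceAbs_le {A P Q : Matrix n n ℂ} (hP : P.PosSemidef) (hQ : Q.PosSemidef)
    (h : A = P - Q) : traceAbs A ≤ P.trace.re + Q.trace.re := by
  obtain ⟨U, d, hU, hd⟩ := exists_eq_conjDiag (h ▸ hP.1.sub hQ.1 : A.IsHermitian)
  rw [hd, traceAbs_conjDiag hU, ← trace_conj_eq hU P, ← trace_conj_eq hU Q,
    ← Finset.sum_add_distrib]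
  refine Finset.sum_le_sum fun i _ => ?_
  rw [conjDiag_diag_eq hU (hd.symm.trans h) i]
  have := conj_diag_nonneg hP U i
  have := conj_diag_nonneg hQ U i
  rw [abs_le]
  constructor <;> linarith

lemma traceNeg_le {A P Q : Matrix n n ℂ} (hP : P.PosSemidef) (hQ : Q.PosSemidef)
    (h : A = P - Q) : traceNeg A ≤ Q.trace.re := by
  obtain ⟨U, d, hU, hd⟩ := exists_eq_conjDiag (h ▸ hP.1.sub hQ.1 : A.IsHermitian)
  rw [hd, traceNeg_conjDiag hU, ← trace_conj_eq hU Q]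
  refine Finset.sum_le_sum fun i _ => ?_
  rw [conjDiag_diag_eq hU (hd.symm.trans h) i]
  have := conj_diag_nonneg hP U i
  have := conj_diag_nonneg hQ U i
  rw [max_le_iff]
  constructor <;> linarith

lemma exists_jordan {A : Matrix n n ℂ} (h : A.IsHermitian) :
    ∃ P Q : Matrix n n ℂ, P.PosSemidef ∧ Q.PosSemidef ∧ A = P - Q ∧
      traceAbs A = P.trace.re + Q.trace.re ∧ traceNeg A = Q.trace.re := by
  obtain ⟨U, d, hU, hd⟩ := exists_eq_conjDiag h
  refine ⟨conjDiag U fun i => max (d i) 0, conjDiag U fun i => max (-d i) 0,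
    conjDiag_posSemidef U fun i => le_max_right _ _,
    conjDiag_posSemidef U fun i => le_max_right _ _, ?_, ?_, ?_⟩
  · rw [conjDiag_sub, hd]
    congr 1
    ext i
    rcases le_total (d i) 0 with h | h <;> simp [h]
  · rw [trace_conjDiag hU, trace_conjDiag hU, hd, traceAbs_conjDiag hU, Complex.ofReal_re,
      Complex.ofReal_re, ← Finset.sum_add_distrib]
    refine Finset.sum_congr rfl fun i _ => ?_
    rcases le_total (d i) 0 with h | h <;> simp [h, abs_of_nonneg, abs_of_nonpos]
  · rw [trace_conjDiag hU, hd, traceNeg_conjDiag hU, Complex.ofReal_re]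

lemma le_traceAbs {A : Matrix n n ℂ} (h : A.IsHermitian) : A.trace.re ≤ traceAbs A := by
  obtain ⟨P, Q, hP, hQ, hA, h1, -⟩ := exists_jordan h
  have := (Complex.nonneg_iff.mp hQ.trace_nonneg).1
  rw [h1, hA, trace_sub, Complex.sub_re]
  linarith

lemma relEnt_conjDiag {U V : Matrix n n ℂ} (hU : Uᴴ * U = 1) (hV : Vᴴ * V = 1) (a b : n → ℝ) :
    relEnt (conjDiag U a) (conjDiag V b) = ∑ i, Real.logb 2 (a i) * a i -
      ∑ i, Real.logb 2 (b i) * ((Vᴴ * conjDiag U a * V) i i).re := by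
  rw [relEnt, hermLog2_conjDiag hU, hermLog2_conjDiag hV, Matrix.mul_sub, trace_sub,
    trace_mul_conjDiag, trace_mul_conjDiag, conjTranspose_conjDiag_mul hU, Complex.sub_re,
    Complex.re_sum, Complex.re_sum]
  simp

end Diagonalization

section Pencil

lemma dotProduct_diagonal_mulVec {n : Type*} [Fintype n] [DecidableEq n] (l : n → ℝ) (y : n → ℂ) :
    star y ⬝ᵥ (diagonal (fun i => ((l i : ℝ) : ℂ)) *ᵥ y) =
      ((∑ i, l i * Complex.normSq (y i) : ℝ) : ℂ) := by
  simp only [dotProduct, mulVec_diagonal, Pi.star_apply, Complex.ofReal_sum, Complex.ofReal_mul,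
    Complex.normSq_eq_conj_mul_self]
  refine Finset.sum_congr rfl fun i _ => ?_
  simp only [RCLike.star_def]
  ring

variable {n : Type*} [Fintype n] [DecidableEq n]

/-- One half of Sylvester's law of inertia. -/
lemma card_neg_le {E : Matrix n n ℂ} {l d : n → ℝ}
    (h : Eᴴ * diagonal (fun i => ((l i : ℝ) : ℂ)) * E = diagonal (fun i => ((d i : ℝ) : ℂ))) :
    (Finset.univ.filter fun i => d i < 0).card ≤ (Finset.univ.filter fun i => l i < 0).card := by
  classical
  have key : Function.Injective
      (E.submatrix (fun i : {i // l i < 0} => (i : n))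
        (fun j : {j // d j < 0} => (j : n))).mulVecLin := by
    rw [← LinearMap.ker_eq_bot, LinearMap.ker_eq_bot']
    intro x hx
    set x' : n → ℂ := fun j => if hj : d j < 0 then x ⟨j, hj⟩ else 0 with hx'
    have hE : ∀ i, l i < 0 → (E *ᵥ x') i = 0 := by
      intro i hi
      have := congrFun hx ⟨i, hi⟩
      simp only [mulVecLin_apply, mulVec, dotProduct, submatrix_apply, Pi.zero_apply] at this ⊢
      rw [← this]
      rw [← Fintype.sum_subtype_add_sum_subtype (fun j => d j < 0) (fun j => E i j * x' j)]
      rw [Finset.sum_eq_zero (s := Finset.univ) (f := fun j : {j // ¬ d j < 0} => E i j * x' j)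
        fun j _ => by simp [hx', j.2], add_zero]
      refine Finset.sum_congr rfl fun j _ => ?_
      simp [hx', j.2]
    have hq := dotProduct_diagonal_mulVec d x'
    rw [← h, ← mulVec_mulVec, ← mulVec_mulVec, dotProduct_mulVec, vecMul_conjTranspose, star_star,
      dotProduct_diagonal_mulVec, Complex.ofReal_inj] at hq
    have h1 : 0 ≤ ∑ i, l i * Complex.normSq ((E *ᵥ x') i) := by
      refine Finset.sum_nonneg fun i _ => ?_
      by_cases hi : l i < 0
      · simp [hE i hi]
      · exact mul_nonneg (not_lt.mp hi) (Complex.normSq_nonneg _)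
    have h2 : ∀ i, d i * Complex.normSq (x' i) ≤ 0 := by
      intro i
      by_cases hi : d i < 0
      · exact mul_nonpos_of_nonpos_of_nonneg hi.le (Complex.normSq_nonneg _)
      · simp [hx', hi]
    have h3 : ∑ i, d i * Complex.normSq (x' i) = 0 :=
      le_antisymm (Finset.sum_nonpos fun i _ => h2 i) (hq ▸ h1)
    rw [Finset.sum_eq_zero_iff_of_nonpos fun i _ => h2 i] at h3
    ext ⟨j, hj⟩
    have := h3 j (Finset.mem_univ j)
    rcases mul_eq_zero.mp this with h4 | h4
    · exact absurd h4 hj.ne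
    · simpa [hx', hj] using h4
  have := LinearMap.finrank_le_finrank_of_injective key
  simpa [Fintype.card_subtype] using this

lemma card_neg_eq {U D D' : Matrix n n ℂ} {l d : n → ℝ} (hU : Uᴴ * U = 1) (hD : D * D' = 1)
    (h : Dᴴ * conjDiag U l * D = diagonal (fun i => ((d i : ℝ) : ℂ))) :
    (Finset.univ.filter fun i => l i < 0).card = (Finset.univ.filter fun i => d i < 0).card := by
  apply le_antisymm
  · refine card_neg_le (E := D' * U) ?_
    have hD2 : D'ᴴ * Dᴴ = 1 := by rw [← conjTranspose_mul, hD, conjTranspose_one]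
    rw [← h, conjTranspose_mul]
    calc Uᴴ * D'ᴴ * (Dᴴ * conjDiag U l * D) * (D' * U)
        = Uᴴ * (D'ᴴ * Dᴴ) * conjDiag U l * (D * D') * U := by simp only [Matrix.mul_assoc]
      _ = Uᴴ * conjDiag U l * U := by rw [hD, hD2, Matrix.mul_one, Matrix.mul_one]
      _ = _ := conjTranspose_conjDiag_mul hU l
  · refine card_neg_le (E := Uᴴ * D) ?_
    rw [← h, conjTranspose_mul, conjTranspose_conjTranspose]
    unfold conjDiag
    simp only [Matrix.mul_assoc]

/-- Simultaneous diagonalization by congruence of two positive definite matrices. -/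
lemma exists_pencil {A B : Matrix n n ℂ} (hA : A.PosDef) (hB : B.PosDef) :
    ∃ (D D' : Matrix n n ℂ) (μ : n → ℝ), D * D' = 1 ∧ Dᴴ * A * D = 1 ∧
      Dᴴ * (B - A) * D = diagonal (fun i => ((μ i : ℝ) : ℂ)) ∧ ∀ i, -1 < μ i := by
  set U := (hA.1.eigenvectorUnitary : Matrix n n ℂ)
  have hU : Uᴴ * U = 1 := eigenvectorUnitary_conjTranspose_mul hA.1
  set a := hA.1.eigenvalues
  have hAe : A = conjDiag U a := eq_conjDiag_eigenvalues hA.1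
  have ha : ∀ i, 0 < a i := hA.eigenvalues_pos
  set S : Matrix n n ℂ := diagonal fun i => (((√(a i))⁻¹ : ℝ) : ℂ)
  have hS : Sᴴ = S := by
    simp only [S, diagonal_conjTranspose]
    congr 1
    ext i
    simp
  set C := U * S
  have hC : Cᴴ * A * C = 1 := by
    calc Cᴴ * A * C = S * (Uᴴ * A * U) * S := by
          simp only [C, conjTranspose_mul, hS, Matrix.mul_assoc]
      _ = 1 := by
        rw [hAe, conjTranspose_conjDiag_mul hU]
        simp only [S, diagonal_mul_diagonal]
        rw [← diagonal_one]
        congr 1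
        ext i
        rw [← Complex.ofReal_mul, ← Complex.ofReal_mul]
        have h1 : √(a i) ≠ 0 := (Real.sqrt_pos.mpr (ha i)).ne'
        have h2 := Real.mul_self_sqrt (ha i).le
        norm_cast
        field_simp
        rw [sq, h2]
  obtain ⟨V, μ, hV, hM⟩ := exists_eq_conjDiag
    (isHermitian_conjTranspose_mul_mul C (hB.1.sub hA.1))
  have h1 : (C * V)ᴴ * A * (C * V) = 1 := by
    calc (C * V)ᴴ * A * (C * V) = Vᴴ * (Cᴴ * A * C) * V := by
          simp only [conjTranspose_mul, Matrix.mul_assoc]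
      _ = 1 := by rw [hC, Matrix.mul_one, hV]
  have h2 : (C * V)ᴴ * (B - A) * (C * V) = diagonal (fun i => ((μ i : ℝ) : ℂ)) := by
    calc (C * V)ᴴ * (B - A) * (C * V) = Vᴴ * (Cᴴ * (B - A) * C) * V := by
          simp only [conjTranspose_mul, Matrix.mul_assoc]
      _ = _ := by rw [hM, conjTranspose_conjDiag_mul hV]
  have hinv : (C * V) * ((C * V)ᴴ * A) = 1 := mul_eq_one_comm.mp h1
  refine ⟨C * V, (C * V)ᴴ * A, μ, hinv, h1, h2, fun i => ?_⟩
  have h3 : (C * V)ᴴ * B * (C * V) = diagonal (fun i => ((1 + μ i : ℝ) : ℂ)) := by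
    have : B = A + (B - A) := by abel
    rw [this, Matrix.mul_add, Matrix.add_mul, h1, h2, ← diagonal_one, diagonal_add]
    simp
  have h4 : ((C * V)ᴴ * B * (C * V)).PosDef :=
    hB.conjTranspose_mul_mul_same (by
      intro x y hxy
      have : ((C * V)ᴴ * A) *ᵥ ((C * V) *ᵥ x) = ((C * V)ᴴ * A) *ᵥ ((C * V) *ᵥ y) := by
        congr 1
      rwa [mulVec_mulVec, mulVec_mulVec, h1, one_mulVec, one_mulVec] at this)
  rw [h3, posDef_diagonal_iff] at h4
  have := h4 i
  rw [Complex.zero_lt_real] at this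
  linarith

lemma det_conjDiag {U : Matrix n n ℂ} (hU : Uᴴ * U = 1) (d : n → ℝ) :
    (conjDiag U d).det = ((∏ i, d i : ℝ) : ℂ) := by
  have h := congrArg Matrix.det (conjTranspose_conjDiag_mul hU d)
  have h1 := congrArg Matrix.det hU
  rw [det_mul, det_one] at h1
  rw [det_mul, det_mul, mul_right_comm, h1, one_mul, det_diagonal] at h
  rw [h, Complex.ofReal_prod]

lemma sum_log_pencil {D D' U V : Matrix n n ℂ} {μ a b : n → ℝ} (hU : Uᴴ * U = 1)
    (hV : Vᴴ * V = 1) (ha : ∀ i, 0 < a i) (hb : ∀ i, 0 < b i) (hD : D * D' = 1)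
    (h1 : Dᴴ * conjDiag U a * D = 1)
    (h2 : Dᴴ * (conjDiag V b - conjDiag U a) * D = diagonal (fun i => ((μ i : ℝ) : ℂ)))
    (hμ : ∀ i, -1 < μ i) :
    ∑ i, (Real.log (1 + μ i) - μ i / (1 + μ i)) =
      ∑ i, Real.log (b i) - ∑ i, Real.log (a i) -
        ∑ i, (b i - ((Vᴴ * conjDiag U a * V) i i).re) * (b i)⁻¹ := by
  have hμ' : ∀ i, 0 < 1 + μ i := fun i => by linarith [hμ i]
  have h3 : Dᴴ * conjDiag V b * D = diagonal (fun i => ((1 + μ i : ℝ) : ℂ)) := by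
    have : conjDiag V b = conjDiag U a + (conjDiag V b - conjDiag U a) := by abel
    rw [this, Matrix.mul_add, Matrix.add_mul, h1, h2, ← diagonal_one, diagonal_add]
    simp
  have hlog : ∑ i, Real.log (1 + μ i) = ∑ i, Real.log (b i) - ∑ i, Real.log (a i) := by
    have e1 := congrArg Matrix.det h1
    have e3 := congrArg Matrix.det h3
    rw [det_mul, det_mul, det_conjDiag hU, det_one] at e1
    rw [det_mul, det_mul, det_conjDiag hV, det_diagonal, ← Complex.ofReal_prod] at e3
    have e : ((∏ i, b i : ℝ) : ℂ) = ((∏ i, (1 + μ i) : ℝ) : ℂ) * ((∏ i, a i : ℝ) : ℂ) := by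
      rw [← e3]
      linear_combination (-((∏ i, b i : ℝ) : ℂ)) * e1
    rw [← Complex.ofReal_mul, Complex.ofReal_inj] at e
    rw [← Real.log_prod (fun i _ => (hμ' i).ne'), ← Real.log_prod (fun i _ => (hb i).ne'),
      ← Real.log_prod (fun i _ => (ha i).ne'), e,
      Real.log_mul (Finset.prod_pos fun i _ => hμ' i).ne' (Finset.prod_pos fun i _ => ha i).ne']
    ring
  have hinv : conjDiag D (fun i => (1 + μ i)⁻¹) = conjDiag V (fun i => (b i)⁻¹) := by
    have i1 : conjDiag D (fun i => (1 + μ i)⁻¹) * conjDiag V b = 1 := by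
      have : diagonal (fun i => (((1 + μ i)⁻¹ : ℝ) : ℂ)) * (Dᴴ * conjDiag V b * D) = 1 := by
        rw [h3, diagonal_mul_diagonal, ← diagonal_one]
        congr 1
        ext i
        rw [← Complex.ofReal_mul, inv_mul_cancel₀ (hμ' i).ne', Complex.ofReal_one]
      calc conjDiag D (fun i => (1 + μ i)⁻¹) * conjDiag V b
          = D * (diagonal (fun i => (((1 + μ i)⁻¹ : ℝ) : ℂ)) * (Dᴴ * conjDiag V b * D)) * D' := by
            rw [show conjDiag D (fun i => (1 + μ i)⁻¹) * conjDiag V b =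
              D * diagonal (fun i => (((1 + μ i)⁻¹ : ℝ) : ℂ)) * Dᴴ * conjDiag V b * (D * D') by
                rw [hD, Matrix.mul_one]; rfl]
            simp only [Matrix.mul_assoc]
        _ = 1 := by rw [this, Matrix.mul_one, hD]
    have i2 : conjDiag V b * conjDiag V (fun i => (b i)⁻¹) = 1 := by
      have : diagonal (fun i => ((b i : ℝ) : ℂ)) * diagonal (fun i => (((b i)⁻¹ : ℝ) : ℂ)) = 1 := by
        rw [diagonal_mul_diagonal, ← diagonal_one]
        congr 1
        ext i
        rw [← Complex.ofReal_mul, mul_inv_cancel₀ (hb i).ne', Complex.ofReal_one]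
      calc conjDiag V b * conjDiag V (fun i => (b i)⁻¹)
          = V * (diagonal (fun i => ((b i : ℝ) : ℂ)) * (Vᴴ * V) *
              diagonal (fun i => (((b i)⁻¹ : ℝ) : ℂ))) * Vᴴ := by
            unfold conjDiag
            simp only [Matrix.mul_assoc]
        _ = 1 := by rw [hV, Matrix.mul_one, this, Matrix.mul_one, mul_eq_one_comm.mp hV]
    exact left_inv_eq_right_inv i1 i2
  have htr : ∑ i, μ i / (1 + μ i) =
      ∑ i, (b i - ((Vᴴ * conjDiag U a * V) i i).re) * (b i)⁻¹ := by
    have t1 := trace_mul_conjDiag (conjDiag V b - conjDiag U a) D (fun i => (1 + μ i)⁻¹)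
    rw [hinv, trace_mul_conjDiag, h2, Matrix.mul_sub, Matrix.sub_mul,
      conjTranspose_conjDiag_mul hV] at t1
    have t2 := congrArg Complex.re t1
    rw [Complex.re_sum, Complex.re_sum] at t2
    simp only [Complex.re_ofReal_mul, Matrix.sub_apply, diagonal_apply_eq, Complex.sub_re,
      Complex.ofReal_re] at t2
    rw [show ∑ i, μ i / (1 + μ i) = ∑ i, (1 + μ i)⁻¹ * μ i from
      Finset.sum_congr rfl fun i _ => by rw [div_eq_mul_inv, mul_comm], ← t2]
    exact Finset.sum_congr rfl fun i _ => mul_comm _ _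
  rw [Finset.sum_sub_distrib, hlog, htr]

end Pencil

section Integrals

open MeasureTheory Set
open scoped Topology ENNReal

lemma lintegral_weight {μ : ℝ} (hμ : -1 < μ) :
    ∫⁻ s : ℝ, ENNReal.ofReal (|s| / (1 + s) ^ 2) * (if 1 - s⁻¹ * μ < 0 then 1 else 0) =
      ENNReal.ofReal (Real.log (1 + μ) - μ / (1 + μ)) := by
  have hderiv : ∀ s : ℝ, -1 < s →
      HasDerivAt (fun s => Real.log (1 + s) + (1 + s)⁻¹) (s / (1 + s) ^ 2) s := by
    intro s hs
    have h1 : HasDerivAt (fun s : ℝ => 1 + s) 1 s := (hasDerivAt_id s).const_add 1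
    have h0 : (1 + s) ≠ 0 := by linarith
    convert! (h1.log h0).add (h1.inv h0) using 1
    field_simp
    ring
  have hcont : ∀ p q : ℝ, -1 < p → ContinuousOn (fun s : ℝ => s / (1 + s) ^ 2) (Icc p q) := by
    intro p q hp
    refine continuousOn_id.div (by fun_prop) fun s hs => ?_
    have : 0 < 1 + s := by linarith [hs.1]
    positivity
  have h_int : ∀ p q : ℝ, -1 < p → p ≤ q → ∫ s in p..q, s / (1 + s) ^ 2 =
      (Real.log (1 + q) + (1 + q)⁻¹) - (Real.log (1 + p) + (1 + p)⁻¹) := by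
    intro p q hp hpq
    refine intervalIntegral.integral_eq_sub_of_hasDerivAt (fun s hs => hderiv s ?_) ?_
    · rw [uIcc_of_le hpq] at hs
      linarith [hs.1]
    · exact (uIcc_of_le hpq ▸ hcont p q hp).intervalIntegrable
  have hμ0 : 1 + μ ≠ 0 := by linarith
  have hset : ∀ S : Set ℝ, MeasurableSet S → (∀ s, (1 - s⁻¹ * μ < 0) ↔ s ∈ S) →
      ∫⁻ s : ℝ, ENNReal.ofReal (|s| / (1 + s) ^ 2) * (if 1 - s⁻¹ * μ < 0 then 1 else 0) =
        ∫⁻ s in S, ENNReal.ofReal (|s| / (1 + s) ^ 2) := by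
    intro S hS h
    rw [← lintegral_indicator hS]
    refine lintegral_congr fun s => ?_
    by_cases hs : s ∈ S
    · rw [if_pos ((h s).mpr hs), mul_one, indicator_of_mem hs]
    · rw [if_neg (fun h' => hs ((h s).mp h')), mul_zero, indicator_of_notMem hs]
  rcases lt_trichotomy μ 0 with h | h | h
  · rw [hset (Ioc μ 0 \ {0}) (measurableSet_Ioc.diff (measurableSet_singleton 0))]
    · rw [setLIntegral_congr (sdiff_null_ae_eq_self (by simp))]
      rw [setLIntegral_congr_fun (g := fun s => ENNReal.ofReal (-(s / (1 + s) ^ 2)))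
        measurableSet_Ioc (fun s hs => by rw [abs_of_nonpos hs.2, neg_div])]
      rw [← ofReal_integral_eq_lintegral_ofReal, integral_neg,
        ← intervalIntegral.integral_of_le h.le, h_int μ 0 hμ h.le]
      · congr 1
        simp
        field_simp
        ring
      · exact (((hcont μ 0 hμ).integrableOn_Icc).mono_set Ioc_subset_Icc_self).neg
      · refine (ae_restrict_iff' measurableSet_Ioc).mpr (ae_of_all _ fun s hs => ?_)
        change 0 ≤ -(s / (1 + s) ^ 2)
        rw [← neg_div]
        exact div_nonneg (neg_nonneg.mpr hs.2) (sq_nonneg _)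
    · intro s
      simp only [Set.mem_sdiff, mem_Ioc, mem_singleton_iff]
      rcases lt_trichotomy s 0 with hs | hs | hs
      · rw [inv_mul_eq_div, sub_neg, one_lt_div_of_neg hs]
        constructor
        · intro h'; exact ⟨⟨h', hs.le⟩, hs.ne⟩
        · intro h'; exact h'.1.1
      · simp [hs]
      · have : s⁻¹ * μ < 0 := mul_neg_of_pos_of_neg (inv_pos.mpr hs) h
        constructor
        · intro; linarith
        · intro; linarith
  · simp [h, not_lt.mpr zero_le_one]
  · rw [hset (Ioc 0 μ \ {μ}) (measurableSet_Ioc.diff (measurableSet_singleton μ))]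
    · rw [setLIntegral_congr (sdiff_null_ae_eq_self (by simp))]
      rw [setLIntegral_congr_fun (g := fun s => ENNReal.ofReal (s / (1 + s) ^ 2))
        measurableSet_Ioc (fun s hs => by rw [abs_of_nonneg hs.1.le])]
      rw [← ofReal_integral_eq_lintegral_ofReal,
        ← intervalIntegral.integral_of_le h.le, h_int 0 μ (by norm_num) h.le]
      · congr 1
        simp
        field_simp
        ring
      · exact ((hcont 0 μ (by norm_num)).integrableOn_Icc).mono_set Ioc_subset_Icc_self
      · refine (ae_restrict_iff' measurableSet_Ioc).mpr (ae_of_all _ fun s hs => ?_)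
        exact div_nonneg hs.1.le (sq_nonneg _)
    · intro s
      simp only [Set.mem_sdiff, mem_Ioc, mem_singleton_iff]
      rcases lt_trichotomy s 0 with hs | hs | hs
      · have : s⁻¹ * μ < 0 := mul_neg_of_neg_of_pos (inv_lt_zero.mpr hs) h
        constructor
        · intro; linarith
        · intro; linarith
      · simp [hs]
      · rw [inv_mul_eq_div, sub_neg, one_lt_div hs]
        constructor
        · intro h'; exact ⟨⟨hs, h'.le⟩, h'.ne⟩
        · intro h'; exact lt_of_le_of_ne h'.1.2 h'.2

lemma lintegral_ite_add_neg (l : ℝ) :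
    ∫⁻ r in Ioi (0 : ℝ), (if l + r < 0 then (1 : ℝ≥0∞) else 0) = ENNReal.ofReal (max (-l) 0) := by
  have : ∀ r, (if l + r < 0 then (1 : ℝ≥0∞) else 0) = (Iio (-l)).indicator (fun _ => 1) r := by
    intro r
    by_cases h : l + r < 0
    · rw [if_pos h, indicator_of_mem (show r ∈ Iio (-l) by simp only [mem_Iio]; linarith)]
    · rw [if_neg h, indicator_of_notMem (show r ∉ Iio (-l) by simp only [mem_Iio]; linarith)]
  simp_rw [this]
  rw [lintegral_indicator measurableSet_Iio, setLIntegral_const, one_mul,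
    Measure.restrict_apply measurableSet_Iio, inter_comm, Ioi_inter_Iio, Real.volume_Ioo, sub_zero]
  rcases le_total (-l) 0 with h | h <;> simp [h]

lemma tendsto_log_add_sub_log (x : ℝ) :
    Tendsto (fun r : ℝ => Real.log (x + r) - Real.log r) atTop (𝓝 0) := by
  have h : Tendsto (fun r : ℝ => Real.log (1 + x / r)) atTop (𝓝 0) := by
    have h1 : Tendsto (fun r : ℝ => 1 + x / r) atTop (𝓝 (1 + 0)) :=
      (tendsto_const_nhds.div_atTop tendsto_id).const_add 1
    rw [add_zero] at h1
    simpa using h1.log one_ne_zero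
  refine h.congr' ?_
  filter_upwards [eventually_gt_atTop 0, eventually_gt_atTop (-x)] with r hr hx
  rw [← Real.log_div (by linarith) hr.ne', add_comm x r, add_div, div_self hr.ne']

lemma tendsto_entropy_shift (x : ℝ) :
    Tendsto (fun r : ℝ => ((x + r) * Real.log (x + r) - (x + r)) - (r * Real.log r - r) -
      x * Real.log r) atTop (𝓝 0) := by
  have h1 := Real.tendsto_mul_log_one_add_div_atTop x
  have h2 := (tendsto_log_add_sub_log x).const_mul x
  have h3 := (h1.add h2).sub_const x
  rw [mul_zero, add_zero, sub_self] at h3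
  refine h3.congr' ?_
  filter_upwards [eventually_gt_atTop 0, eventually_gt_atTop (-x)] with r hr hx
  have : Real.log (1 + x / r) = Real.log (x + r) - Real.log r := by
    rw [← Real.log_div (by linarith) hr.ne', add_comm x r, add_div, div_self hr.ne']
  rw [this]
  ring

lemma lintegral_log_shift {n : Type*} [Fintype n] {a b α : n → ℝ} (ha : ∀ i, 0 ≤ a i)
    (hb : ∀ i, 0 ≤ b i) (hα : ∀ i, b i = 0 → α i = 0) (hab : ∑ i, a i = ∑ i, b i)
    (hαa : ∑ i, α i = ∑ i, a i)
    (hpos : ∀ r, 0 < r → 0 ≤ ∑ i, Real.log (b i + r) - ∑ i, Real.log (a i + r) -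
      ∑ i, (b i - α i) * (b i + r)⁻¹) :
    0 ≤ ∑ i, a i * Real.log (a i) - ∑ i, α i * Real.log (b i) ∧
    ∫⁻ r in Ioi (0 : ℝ), ENNReal.ofReal (∑ i, Real.log (b i + r) - ∑ i, Real.log (a i + r) -
      ∑ i, (b i - α i) * (b i + r)⁻¹) =
      ENNReal.ofReal (∑ i, a i * Real.log (a i) - ∑ i, α i * Real.log (b i)) := by
  set G : ℝ → ℝ := fun r => ∑ i, ((b i + r) * Real.log (b i + r) - (b i + r)) -
    ∑ i, ((a i + r) * Real.log (a i + r) - (a i + r)) - ∑ i, (b i - α i) * Real.log (b i + r)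
    with hG
  have hphi : Continuous fun x : ℝ => x * Real.log x - x :=
    Real.continuous_mul_log.sub continuous_id
  have hcont : ContinuousWithinAt G (Ici 0) 0 := by
    apply ContinuousAt.continuousWithinAt
    refine (ContinuousAt.sub ?_ ?_).sub ?_
    · exact (continuous_finsetSum _ fun i _ =>
        hphi.comp (continuous_const.add continuous_id)).continuousAt
    · exact (continuous_finsetSum _ fun i _ =>
        hphi.comp (continuous_const.add continuous_id)).continuousAt
    · refine tendsto_finsetSum _ fun i _ => ?_
      by_cases h : b i = 0
      · simp only [h, hα i h, sub_self, zero_mul]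
        exact tendsto_const_nhds
      · have : ContinuousAt (fun r => (b i - α i) * Real.log (b i + r)) 0 :=
          (ContinuousAt.log (by fun_prop) (by simpa using h)).const_mul _
        exact this
  have hd : ∀ (x r : ℝ), 0 < x + r → HasDerivAt (fun r => Real.log (x + r)) ((x + r)⁻¹) r := by
    intro x r h
    have h1 : HasDerivAt (fun r : ℝ => x + r) 1 r := (hasDerivAt_id r).const_add x
    simpa using h1.log h.ne'
  have hd2 : ∀ (x r : ℝ), 0 < x + r →
      HasDerivAt (fun r => (x + r) * Real.log (x + r) - (x + r)) (Real.log (x + r)) r := by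
    intro x r h
    have h1 : HasDerivAt (fun r : ℝ => x + r) 1 r := (hasDerivAt_id r).const_add x
    convert! (h1.mul (hd x r h)).sub h1 using 1
    rw [mul_inv_cancel₀ h.ne']
    ring
  have hderiv : ∀ r ∈ Ioi (0 : ℝ), HasDerivAt G (∑ i, Real.log (b i + r) -
      ∑ i, Real.log (a i + r) - ∑ i, (b i - α i) * (b i + r)⁻¹) r := by
    intro r hr
    refine (HasDerivAt.sub ?_ ?_).sub ?_
    · exact HasDerivAt.fun_sum fun i _ => hd2 _ _ (add_pos_of_nonneg_of_pos (hb i) hr)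
    · exact HasDerivAt.fun_sum fun i _ => hd2 _ _ (add_pos_of_nonneg_of_pos (ha i) hr)
    · exact HasDerivAt.fun_sum fun i _ =>
        (hd _ _ (add_pos_of_nonneg_of_pos (hb i) hr)).const_mul _
  have hlim : Tendsto G atTop (𝓝 0) := by
    have t1 := tendsto_finsetSum (Finset.univ : Finset n) fun i _ => tendsto_entropy_shift (b i)
    have t2 := tendsto_finsetSum (Finset.univ : Finset n) fun i _ => tendsto_entropy_shift (a i)
    have t3 := tendsto_finsetSum (Finset.univ : Finset n) fun i _ =>
      (tendsto_log_add_sub_log (b i)).const_mul (b i - α i)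
    have t := (t1.sub t2).sub t3
    simp only [mul_zero, Finset.sum_const_zero, sub_self] at t
    refine t.congr fun r => ?_
    simp only [hG, mul_sub, Finset.sum_sub_distrib, ← Finset.sum_mul, sub_mul]
    rw [hαa, hab]
    ring
  have h_int := integral_Ioi_of_hasDerivAt_of_nonneg hcont hderiv (fun r hr => hpos r hr) hlim
  have hG0 : 0 - G 0 = ∑ i, a i * Real.log (a i) - ∑ i, α i * Real.log (b i) := by
    simp only [hG, add_zero, sub_mul, Finset.sum_sub_distrib]
    rw [hab]
    ring
  rw [hG0] at h_int
  refine ⟨h_int ▸ setIntegral_nonneg measurableSet_Ioi fun r hr => hpos r hr, ?_⟩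
  rw [← h_int, ofReal_integral_eq_lintegral_ofReal]
  · exact integrableOn_Ioi_deriv_of_nonneg hcont hderiv (fun r hr => hpos r hr) hlim
  · exact (ae_restrict_iff' measurableSet_Ioi).mpr (ae_of_all _ fun r hr => hpos r hr)

end Integrals

section IntegralFormula

open MeasureTheory Set
open scoped Topology ENNReal

section

variable {n : Type*} [DecidableEq n]

/-- The pencil `A - u (B - A) + r`. -/
def pencil (A B : Matrix n n ℂ) (u r : ℝ) : Matrix n n ℂ :=
  A - (u : ℂ) • (B - A) + (r : ℂ) • 1

lemma pencil_isHermitian {A B : Matrix n n ℂ} (hA : A.IsHermitian) (hB : B.IsHermitian)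
    (u r : ℝ) : (pencil A B u r).IsHermitian := by
  have h : ∀ (x : ℝ) {M : Matrix n n ℂ}, M.IsHermitian → ((x : ℂ) • M).IsHermitian := by
    intro x M hM
    rw [Matrix.IsHermitian, conjTranspose_smul, hM]
    simp
  exact (hA.sub (h u (hB.sub hA))).add (h r isHermitian_one)

lemma pencil_add {A B : Matrix n n ℂ} (u r t : ℝ) :
    pencil A B u (r + t) = pencil A B u r + (t : ℂ) • 1 := by
  simp only [pencil, Complex.ofReal_add]
  module

end

variable {n : Type*} [Fintype n] [DecidableEq n]

lemma traceNeg_convex {X Y : Matrix n n ℂ} (hX : X.IsHermitian) (hY : Y.IsHermitian) {p q : ℝ}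
    (hp : 0 ≤ p) (hq : 0 ≤ q) :
    traceNeg ((p : ℂ) • X + (q : ℂ) • Y) ≤ p * traceNeg X + q * traceNeg Y := by
  obtain ⟨P, Q, hP, hQ, hXe, -, h1⟩ := exists_jordan hX
  obtain ⟨P', Q', hP', hQ', hYe, -, h2⟩ := exists_jordan hY
  have hpc : (0 : ℂ) ≤ (p : ℂ) := by exact_mod_cast hp
  have hqc : (0 : ℂ) ≤ (q : ℂ) := by exact_mod_cast hq
  refine (traceNeg_le ((hP.smul hpc).add (hP'.smul hqc)) ((hQ.smul hpc).add (hQ'.smul hqc))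
    ?_).trans_eq ?_
  · rw [hXe, hYe, smul_sub, smul_sub]
    abel
  · rw [h1, h2, trace_add, trace_smul, trace_smul]
    simp

lemma continuous_traceNeg_pencil {A B : Matrix n n ℂ} (hA : A.IsHermitian) (hB : B.IsHermitian) :
    Continuous fun x : ℝ × ℝ => traceNeg (pencil A B x.1 x.2) := by
  rw [← continuousOn_univ]
  refine ConvexOn.continuousOn isOpen_univ ⟨convex_univ, ?_⟩
  intro x _ y _ p q hp hq hpq
  refine le_trans (le_of_eq ?_) (traceNeg_convex (pencil_isHermitian hA hB x.1 x.2)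
    (pencil_isHermitian hA hB y.1 y.2) hp hq)
  refine congrArg traceNeg ?_
  have hpq' : (p : ℂ) + q = 1 := by exact_mod_cast hpq
  have hA' : A = (p : ℂ) • A + (q : ℂ) • A := by rw [← add_smul, hpq', one_smul]
  simp only [pencil, Prod.fst_add, Prod.snd_add, Prod.smul_fst, Prod.smul_snd, smul_eq_mul,
    Complex.ofReal_add, Complex.ofReal_mul]
  generalize (p : ℂ) = p' at *
  generalize (q : ℂ) = q' at *
  calc _ = (p' • A + q' • A) - (p' * x.1 + q' * y.1) • (B - A) + (p' * x.2 + q' * y.2) • 1 := by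
        rw [← hA']
    _ = _ := by module

/-- Number of negative eigenvalues. -/
def negCount (A : Matrix n n ℂ) : ℕ :=
  if h : A.IsHermitian then (Finset.univ.filter fun i => h.eigenvalues i < 0).card else 0

lemma negCount_conjDiag {U : Matrix n n ℂ} (hU : Uᴴ * U = 1) (d : n → ℝ) :
    negCount (conjDiag U d) = (Finset.univ.filter fun i => d i < 0).card := by
  have h := conjDiag_isHermitian U d
  rw [negCount, dif_pos h]
  have := sum_comp_eq hU (eigenvectorUnitary_conjTranspose_mul h)
    (eq_conjDiag_eigenvalues h) (fun x => if x < 0 then 1 else 0)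
  rw [Finset.sum_boole, Finset.sum_boole] at this
  exact_mod_cast this.symm

lemma negCount_congruence {X D D' : Matrix n n ℂ} {d : n → ℝ} (hX : X.IsHermitian)
    (hD : D * D' = 1) (h : Dᴴ * X * D = diagonal (fun i => ((d i : ℝ) : ℂ))) :
    negCount X = (Finset.univ.filter fun i => d i < 0).card := by
  obtain ⟨U, l, hU, rfl⟩ := exists_eq_conjDiag hX
  rw [negCount_conjDiag hU, card_neg_eq hU hD h]

lemma tendsto_negCount_scalar (x : ℝ) :
    Tendsto (fun k : ℕ => ((k : ℝ) + 1) * (max (-x) 0 - max (-(x + ((k : ℝ) + 1)⁻¹)) 0)) atTop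
      (𝓝 (if x < 0 then 1 else 0)) := by
  have hk : ∀ k : ℕ, (0 : ℝ) < (k : ℝ) + 1 := fun k => by positivity
  split_ifs with h
  · refine tendsto_const_nhds.congr' ?_
    have h1 : Tendsto (fun k : ℕ => ((k : ℝ) + 1)⁻¹) atTop (𝓝 0) := by
      simpa using tendsto_one_div_add_atTop_nhds_zero_nat (𝕜 := ℝ)
    filter_upwards [h1.eventually_lt_const (neg_pos.mpr h)] with k hk'
    rw [max_eq_left (by linarith), max_eq_left (by linarith)]
    have := (hk k).ne'
    field_simp
    ring
  · refine tendsto_const_nhds.congr fun k => ?_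
    have := inv_pos.mpr (hk k)
    rw [max_eq_right (by linarith), max_eq_right (by linarith)]
    ring

lemma tendsto_negCount {X : Matrix n n ℂ} (hX : X.IsHermitian) :
    Tendsto (fun k : ℕ => ((k : ℝ) + 1) *
      (traceNeg X - traceNeg (X + ((((k : ℝ) + 1)⁻¹ : ℝ) : ℂ) • 1))) atTop
      (𝓝 (negCount X : ℝ)) := by
  obtain ⟨U, l, hU, rfl⟩ := exists_eq_conjDiag hX
  have := tendsto_finsetSum (Finset.univ : Finset n) fun i _ => tendsto_negCount_scalar (l i)
  rw [Finset.sum_boole, ← negCount_conjDiag hU] at this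
  refine this.congr fun k => ?_
  rw [conjDiag_add_smul_one hU, traceNeg_conjDiag hU, traceNeg_conjDiag hU,
    ← Finset.sum_sub_distrib, Finset.mul_sum]

lemma measurable_negCount {A B : Matrix n n ℂ} (hA : A.IsHermitian) (hB : B.IsHermitian) :
    Measurable fun x : ℝ × ℝ => (negCount (pencil A B x.1⁻¹ x.2) : ℝ) := by
  have hc := (continuous_traceNeg_pencil hA hB).measurable
  refine measurable_of_tendsto_metrizable (f := fun (k : ℕ) (x : ℝ × ℝ) => ((k : ℝ) + 1) *
    (traceNeg (pencil A B x.1⁻¹ x.2) -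
      traceNeg (pencil A B x.1⁻¹ (x.2 + ((k : ℝ) + 1)⁻¹)))) (fun k => ?_) ?_
  · refine Measurable.const_mul ?_ _
    refine Measurable.sub ?_ ?_
    · exact hc.comp (g := fun x : ℝ × ℝ => traceNeg (pencil A B x.1 x.2))
        (f := fun x : ℝ × ℝ => (x.1⁻¹, x.2)) (by fun_prop)
    · exact hc.comp (g := fun x : ℝ × ℝ => traceNeg (pencil A B x.1 x.2))
        (f := fun x : ℝ × ℝ => (x.1⁻¹, x.2 + ((k : ℝ) + 1)⁻¹)) (by fun_prop)
  · rw [tendsto_pi_nhds]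
    intro x
    simp only [pencil_add]
    exact tendsto_negCount (pencil_isHermitian hA hB _ _)

lemma lintegral_negCount {X : Matrix n n ℂ} (hX : X.IsHermitian) :
    ∫⁻ r in Ioi (0 : ℝ), (negCount (X + (r : ℂ) • 1) : ℝ≥0∞) = ENNReal.ofReal (traceNeg X) := by
  obtain ⟨U, l, hU, rfl⟩ := exists_eq_conjDiag hX
  have : ∀ r : ℝ, (negCount (conjDiag U l + (r : ℂ) • 1) : ℝ≥0∞) =
      ∑ i, if l i + r < 0 then (1 : ℝ≥0∞) else 0 := by
    intro r
    rw [conjDiag_add_smul_one hU, negCount_conjDiag hU, Finset.sum_boole]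
  simp_rw [this]
  rw [lintegral_finsetSum, traceNeg_conjDiag hU,
    ENNReal.ofReal_sum_of_nonneg fun i _ => le_max_right _ _]
  · exact Finset.sum_congr rfl fun i _ => lintegral_ite_add_neg _
  · intro i _
    exact Measurable.ite (measurableSet_lt (by fun_prop) measurable_const) measurable_const
      measurable_const

lemma log_sub_div_nonneg {x : ℝ} (hx : -1 < x) : 0 ≤ Real.log (1 + x) - x / (1 + x) := by
  have h : 0 < 1 + x := by linarith
  have := Real.one_sub_inv_le_log_of_pos h
  have e : x / (1 + x) = 1 - (1 + x)⁻¹ := by field_simp; ring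
  linarith

lemma conjDiag_posDef {U : Matrix n n ℂ} (hU : Uᴴ * U = 1) {d : n → ℝ} (hd : ∀ i, 0 < d i) :
    (conjDiag U d).PosDef := by
  have h : (diagonal fun i => ((d i : ℝ) : ℂ)).PosDef :=
    posDef_diagonal_iff.mpr fun i => by simpa using hd i
  refine h.mul_mul_conjTranspose_same (B := U) ?_
  intro x y hxy
  have : (x ᵥ* U) ᵥ* Uᴴ = (y ᵥ* U) ᵥ* Uᴴ := by
    have hxy' : x ᵥ* U = y ᵥ* U := hxy
    rw [hxy']
  rwa [vecMul_vecMul, vecMul_vecMul, mul_eq_one_comm.mp hU, vecMul_one, vecMul_one] at this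

lemma shifted_integrand {U V : Matrix n n ℂ} {a b : n → ℝ} (hU : Uᴴ * U = 1) (hV : Vᴴ * V = 1)
    (ha : ∀ i, 0 ≤ a i) (hb : ∀ i, 0 ≤ b i) {r : ℝ} (hr : 0 < r) :
    0 ≤ ∑ i, Real.log (b i + r) - ∑ i, Real.log (a i + r) -
        ∑ i, (b i - ((Vᴴ * conjDiag U a * V) i i).re) * (b i + r)⁻¹ ∧
    ENNReal.ofReal (∑ i, Real.log (b i + r) - ∑ i, Real.log (a i + r) -
        ∑ i, (b i - ((Vᴴ * conjDiag U a * V) i i).re) * (b i + r)⁻¹) =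
      ∫⁻ s : ℝ, ENNReal.ofReal (|s| / (1 + s) ^ 2) *
        (negCount (pencil (conjDiag U a) (conjDiag V b) s⁻¹ r) : ℝ≥0∞) := by
  have ha' : ∀ i, 0 < a i + r := fun i => add_pos_of_nonneg_of_pos (ha i) hr
  have hb' : ∀ i, 0 < b i + r := fun i => add_pos_of_nonneg_of_pos (hb i) hr
  obtain ⟨D, D', μ, hD, h1, h2, hμ⟩ := exists_pencil (conjDiag_posDef hU ha')
    (conjDiag_posDef hV hb')
  have hsum := sum_log_pencil hU hV ha' hb' hD h1 h2 hμ
  have hdiag : ∀ i, ((Vᴴ * conjDiag U (fun i => a i + r) * V) i i).re =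
      ((Vᴴ * conjDiag U a * V) i i).re + r := by
    intro i
    rw [← conjDiag_add_smul_one hU, Matrix.mul_add, Matrix.add_mul, Matrix.mul_smul,
      Matrix.smul_mul, Matrix.mul_one, hV, Matrix.add_apply, Matrix.smul_apply, one_apply_eq]
    simp
  simp only [hdiag, add_sub_add_right_eq_sub] at hsum
  rw [← hsum]
  have hcount : ∀ s : ℝ, (negCount (pencil (conjDiag U a) (conjDiag V b) s⁻¹ r) : ℝ≥0∞) =
      ∑ i, if 1 - s⁻¹ * μ i < 0 then (1 : ℝ≥0∞) else 0 := by
    intro s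
    rw [negCount_congruence (pencil_isHermitian (conjDiag_isHermitian _ _)
      (conjDiag_isHermitian _ _) _ _) hD (d := fun i => 1 - s⁻¹ * μ i), Finset.sum_boole]
    have : pencil (conjDiag U a) (conjDiag V b) s⁻¹ r = conjDiag U (fun i => a i + r) -
        ((s⁻¹ : ℝ) : ℂ) • (conjDiag V (fun i => b i + r) - conjDiag U (fun i => a i + r)) := by
      rw [← conjDiag_add_smul_one hU, ← conjDiag_add_smul_one hV, pencil]
      module
    rw [this, Matrix.mul_sub, Matrix.sub_mul, h1, Matrix.mul_smul, Matrix.smul_mul, h2,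
      ← diagonal_one, ← diagonal_smul, diagonal_sub]
    congr 1
    ext i
    simp
  simp_rw [hcount, Finset.mul_sum]
  refine ⟨Finset.sum_nonneg fun i _ => log_sub_div_nonneg (hμ i), ?_⟩
  rw [lintegral_finsetSum, ENNReal.ofReal_sum_of_nonneg fun i _ => log_sub_div_nonneg (hμ i)]
  · exact Finset.sum_congr rfl fun i _ => (lintegral_weight (hμ i)).symm
  · intro i _
    refine Measurable.mul (by fun_prop) ?_
    exact Measurable.ite (measurableSet_lt (by fun_prop) measurable_const) measurable_const
      measurable_const

/-- If `ker B ⊆ ker A` then the diagonal of `A` in an eigenbasis of `B` vanishes where `B` does. -/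
lemma conj_diag_eq_zero {A V : Matrix n n ℂ} {b : n → ℝ} (hV : Vᴴ * V = 1)
    (hker : ∀ v, conjDiag V b *ᵥ v = 0 → A *ᵥ v = 0) {i : n} (hi : b i = 0) (j : n) :
    (Vᴴ * A * V) j i = 0 := by
  have h0 : conjDiag V b *ᵥ (V *ᵥ Pi.single i 1) = 0 := by
    rw [mulVec_mulVec, conjDiag, Matrix.mul_assoc, hV, Matrix.mul_one, ← mulVec_mulVec,
      diagonal_mulVec_single, hi]
    simp
  have h1 := hker _ h0
  have h2 : (Vᴴ * A * V) *ᵥ Pi.single i 1 = 0 := by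
    rw [← mulVec_mulVec, ← mulVec_mulVec, h1, mulVec_zero]
  have h3 := congrFun h2 j
  simpa [mulVec_single] using h3

/-- Integral formula for the relative entropy (in nats), in terms of the traces of the negative
parts of the matrices `A - s⁻¹ (B - A)`. -/
lemma relEnt_integral_formula {A B : Matrix n n ℂ} (hA : A.PosSemidef) (hB : B.PosSemidef)
    (htr : A.trace = B.trace) (hker : ∀ v, B *ᵥ v = 0 → A *ᵥ v = 0) :
    0 ≤ relEnt A B ∧ ENNReal.ofReal (Real.log 2 * relEnt A B) =
      ∫⁻ s : ℝ, ENNReal.ofReal (|s| / (1 + s) ^ 2) *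
        ENNReal.ofReal (traceNeg (A - ((s⁻¹ : ℝ) : ℂ) • (B - A))) := by
  obtain ⟨U, a, hU, ha, hAe⟩ := exists_eq_conjDiag_of_posSemidef hA
  obtain ⟨V, b, hV, hb, hBe⟩ := exists_eq_conjDiag_of_posSemidef hB
  have hl2 : (0 : ℝ) < Real.log 2 := Real.log_pos one_lt_two
  set α : n → ℝ := fun i => ((Vᴴ * conjDiag U a * V) i i).re with hα
  have hrel : Real.log 2 * relEnt A B =
      ∑ i, a i * Real.log (a i) - ∑ i, α i * Real.log (b i) := by
    rw [hAe, hBe, relEnt_conjDiag hU hV, mul_sub, Finset.mul_sum, Finset.mul_sum]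
    congr 1 <;> refine Finset.sum_congr rfl fun i _ => ?_ <;>
    · simp only [Real.logb, hα]
      field_simp
  have hα0 : ∀ i, b i = 0 → α i = 0 := by
    intro i hi
    simp only [hα]
    rw [conj_diag_eq_zero hV (fun v => by rw [← hAe, ← hBe]; exact hker v) hi i, Complex.zero_re]
  have hab : ∑ i, a i = ∑ i, b i := by
    rw [hAe, hBe, trace_conjDiag hU, trace_conjDiag hV] at htr
    exact Complex.ofReal_inj.mp htr
  have hαa : ∑ i, α i = ∑ i, a i := by
    rw [hα, trace_conj_eq hV, trace_conjDiag hU, Complex.ofReal_re]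
  obtain ⟨hnn, h_int⟩ := lintegral_log_shift ha hb hα0 hab hαa
    (fun r hr => (shifted_integrand hU hV ha hb hr).1)
  rw [← hrel] at hnn h_int
  refine ⟨nonneg_of_mul_nonneg_right hnn hl2, ?_⟩
  rw [← h_int, setLIntegral_congr_fun measurableSet_Ioi
    (fun r hr => (shifted_integrand hU hV ha hb hr).2), ← hAe, ← hBe,
    lintegral_lintegral_swap]
  · refine lintegral_congr fun s => ?_
    rw [lintegral_const_mul']
    · congr 1
      refine Eq.trans (lintegral_congr fun r => ?_)
        (lintegral_negCount (X := A - ((s⁻¹ : ℝ) : ℂ) • (B - A)) ?_)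
      · rfl
      · simpa [pencil] using pencil_isHermitian hA.1 hB.1 s⁻¹ 0
    · exact ENNReal.ofReal_ne_top
  · refine Measurable.aemeasurable ?_
    have hm := (measurable_negCount hA.1 hB.1).comp (measurable_swap (α := ℝ) (β := ℝ))
    have hm' := hm.ennreal_ofReal
    simp only [Function.comp_def, ENNReal.ofReal_natCast, Prod.fst_swap, Prod.snd_swap] at hm'
    exact Measurable.mul (by fun_prop) hm'

end IntegralFormula

section Monotonicity

open MeasureTheory Set
open scoped ENNReal

variable {n m : Type*} [Fintype n] [DecidableEq n] [Fintype m]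

/-- If `ker B ⊆ ker A` then `A` is dominated by a multiple of `B`. -/
lemma exists_smul_sub_posSemidef {A B : Matrix n n ℂ} (hA : A.PosSemidef) (hB : B.PosSemidef)
    (hker : ∀ v, B *ᵥ v = 0 → A *ᵥ v = 0) : ∃ C : ℝ, ((C : ℂ) • B - A).PosSemidef := by
  obtain ⟨U, a, hU, ha, hAe⟩ := exists_eq_conjDiag_of_posSemidef hA
  obtain ⟨V, b, hV, hb, hBe⟩ := exists_eq_conjDiag_of_posSemidef hB
  set t : ℝ := ∑ i, a i
  have ht : 0 ≤ t := Finset.sum_nonneg fun i _ => ha i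
  set p : n → ℝ := fun i => if b i = 0 then 0 else 1 with hp
  set P := conjDiag V p
  have hPH : Pᴴ = P := conjDiag_isHermitian V p
  have hPP : P * P = P := by
    have h1 : diagonal (fun i => ((p i : ℝ) : ℂ)) * diagonal (fun i => ((p i : ℝ) : ℂ)) =
        diagonal (fun i => ((p i : ℝ) : ℂ)) := by
      rw [diagonal_mul_diagonal]
      congr 1
      ext i
      by_cases h : b i = 0 <;> simp [hp, h]
    calc P * P = V * (diagonal (fun i => ((p i : ℝ) : ℂ)) * (Vᴴ * V) *
          diagonal (fun i => ((p i : ℝ) : ℂ))) * Vᴴ := by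
          simp only [P, conjDiag, Matrix.mul_assoc]
      _ = P := by rw [hV, Matrix.mul_one, h1]; rfl
  have hAP : A * P = A := by
    have h1 : (Vᴴ * A * V) * diagonal (fun i => ((p i : ℝ) : ℂ)) = Vᴴ * A * V := by
      ext i j
      rw [mul_diagonal]
      by_cases h : b j = 0
      · rw [conj_diag_eq_zero hV (fun v => by rw [← hBe]; exact hker v) h i, zero_mul]
      · simp [hp, h]
    have hV' := mul_eq_one_comm.mp hV
    calc A * P = (V * Vᴴ) * A * P := by rw [hV', Matrix.one_mul]
      _ = V * ((Vᴴ * A * V) * diagonal (fun i => ((p i : ℝ) : ℂ))) * Vᴴ := by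
        simp only [P, conjDiag, Matrix.mul_assoc]
      _ = (V * Vᴴ) * A * (V * Vᴴ) := by rw [h1]; simp only [Matrix.mul_assoc]
      _ = A := by rw [hV', Matrix.one_mul, Matrix.mul_one]
  have hPAP : Pᴴ * A * P = A := by
    rw [Matrix.mul_assoc, hAP]
    have := congrArg conjTranspose hAP
    rwa [conjTranspose_mul, hA.1] at this
  have h1 : ((t : ℂ) • 1 - A).PosSemidef := by
    rw [hAe, ← conjDiag_const hU, conjDiag_sub]
    exact conjDiag_posSemidef U fun i =>
      sub_nonneg.mpr (Finset.single_le_sum (fun j _ => ha j) (Finset.mem_univ i))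
  have h2 := h1.conjTranspose_mul_mul_same P
  rw [Matrix.mul_sub, Matrix.sub_mul, hPAP, hPH, Matrix.mul_smul, Matrix.smul_mul,
    Matrix.mul_one, hPP] at h2
  refine ⟨∑ i, t * (b i)⁻¹, ?_⟩
  have h3 : (((∑ i, t * (b i)⁻¹ : ℝ) : ℂ) • B - (t : ℂ) • P).PosSemidef := by
    have hs : ∀ (r : ℝ) (d : n → ℝ), (r : ℂ) • conjDiag V d = conjDiag V (fun i => r * d i) := by
      intro r d
      rw [conjDiag, conjDiag, ← Matrix.smul_mul, ← Matrix.mul_smul, ← diagonal_smul]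
      congr 3
      ext i
      simp
    rw [hBe, hs, hs, conjDiag_sub]
    refine conjDiag_posSemidef V fun i => ?_
    by_cases h : b i = 0
    · simp [hp, h]
    · simp only [hp, h, if_false, mul_one]
      have h4 : t * (b i)⁻¹ ≤ ∑ i, t * (b i)⁻¹ :=
        Finset.single_le_sum (f := fun i => t * (b i)⁻¹)
          (fun j _ => mul_nonneg ht (inv_nonneg.mpr (hb j))) (Finset.mem_univ i)
      have h5 := mul_le_mul_of_nonneg_right h4 (hb i)
      rw [mul_assoc, inv_mul_cancel₀ h, mul_one] at h5
      linarith
  have := h3.add h2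
  rwa [sub_add_sub_cancel] at this

variable {Ψ : Matrix n n ℂ →ₗ[ℂ] Matrix m m ℂ}

lemma map_ker_le (hpos : ∀ M, M.PosSemidef → (Ψ M).PosSemidef) {A B : Matrix n n ℂ}
    (hA : A.PosSemidef) (hB : B.PosSemidef) (hker : ∀ v, B *ᵥ v = 0 → A *ᵥ v = 0)
    (v : m → ℂ) (hv : Ψ B *ᵥ v = 0) : Ψ A *ᵥ v = 0 := by
  obtain ⟨C, hC⟩ := exists_smul_sub_posSemidef hA hB hker
  have h1 := (hpos _ hC).dotProduct_mulVec_nonneg v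
  rw [map_sub, map_smul, sub_mulVec, smul_mulVec, hv, smul_zero, zero_sub, dotProduct_neg] at h1
  rw [← (hpos _ hA).dotProduct_mulVec_zero_iff]
  exact le_antisymm (neg_nonneg.mp h1) ((hpos _ hA).dotProduct_mulVec_nonneg v)

variable [DecidableEq m]

lemma traceNeg_map_le (htr : ∀ M, (Ψ M).trace = M.trace)
    (hpos : ∀ M, M.PosSemidef → (Ψ M).PosSemidef) {X : Matrix n n ℂ} (hX : X.IsHermitian) :
    traceNeg (Ψ X) ≤ traceNeg X := by
  obtain ⟨P, Q, hP, hQ, hXe, -, h⟩ := exists_jordan hX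
  rw [h, ← htr Q]
  exact traceNeg_le (hpos P hP) (hpos Q hQ) (by rw [hXe, map_sub])

/-- Data processing inequality for the relative entropy under positive trace-preserving maps. -/
theorem relEnt_map_le (htr : ∀ M, (Ψ M).trace = M.trace)
    (hpos : ∀ M, M.PosSemidef → (Ψ M).PosSemidef) {A B : Matrix n n ℂ}
    (hA : A.PosSemidef) (hB : B.PosSemidef) (hAB : A.trace = B.trace)
    (hker : ∀ v, B *ᵥ v = 0 → A *ᵥ v = 0) : relEnt (Ψ A) (Ψ B) ≤ relEnt A B := by
  obtain ⟨h0, h⟩ := relEnt_integral_formula hA hB hAB hker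
  obtain ⟨-, h'⟩ := relEnt_integral_formula (hpos A hA) (hpos B hB)
    (by rw [htr, htr, hAB]) (map_ker_le hpos hA hB hker)
  have hl2 : (0 : ℝ) < Real.log 2 := Real.log_pos one_lt_two
  have key : ENNReal.ofReal (Real.log 2 * relEnt (Ψ A) (Ψ B)) ≤
      ENNReal.ofReal (Real.log 2 * relEnt A B) := by
    rw [h, h']
    refine lintegral_mono fun s => ?_
    gcongr
    rw [← map_sub, ← map_smul, ← map_sub]
    refine traceNeg_map_le htr hpos ?_
    simpa [pencil] using pencil_isHermitian hA.1 hB.1 s⁻¹ 0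
  rw [ENNReal.ofReal_le_ofReal_iff (mul_nonneg hl2.le h0)] at key
  exact le_of_mul_le_mul_left key hl2

lemma traceAbs_map_le (htr : ∀ M, (Ψ M).trace = M.trace)
    (hpos : ∀ M, M.PosSemidef → (Ψ M).PosSemidef) {X : Matrix n n ℂ} (hX : X.IsHermitian) :
    traceAbs (Ψ X) ≤ traceAbs X := by
  obtain ⟨P, Q, hP, hQ, hXe, h, -⟩ := exists_jordan hX
  rw [h, ← htr P, ← htr Q]
  exact traceAbs_le (hpos P hP) (hpos Q hQ) (by rw [hXe, map_sub])

/-- Convexity of the relative entropy in its first argument. -/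
lemma relEnt_convex {ρ ρ' : Matrix n n ℂ} (σ : Matrix n n ℂ) (hρ : ρ.PosSemidef)
    (hρ' : ρ'.PosSemidef) (htr : ρ.trace = ρ'.trace) {p : ℝ} (hp0 : 0 < p) (hp1 : p < 1) :
    relEnt ((p : ℂ) • ρ + ((1 - p : ℝ) : ℂ) • ρ') σ ≤
      p * relEnt ρ σ + (1 - p) * relEnt ρ' σ := by
  set q : ℝ := 1 - p with hq
  have hq0 : 0 < q := by linarith
  have hpc : (0 : ℂ) < (p : ℂ) := by exact_mod_cast hp0
  have hqc : (0 : ℂ) < (q : ℂ) := by exact_mod_cast hq0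
  have hpq : (p : ℂ) + q = 1 := by rw [hq]; push_cast; ring
  have h1 := hρ.smul hpc.le
  have h2 := hρ'.smul hqc.le
  set ω := (p : ℂ) • ρ + (q : ℂ) • ρ' with hω
  have hωpos : ω.PosSemidef := h1.add h2
  have htr1 : ρ.trace = ω.trace := by
    rw [hω, trace_add, trace_smul, trace_smul, ← htr, ← add_smul, hpq, one_smul]
  have hker : ∀ v, ω *ᵥ v = 0 → ρ *ᵥ v = 0 ∧ ρ' *ᵥ v = 0 := by
    intro v hv
    have e : star v ⬝ᵥ (((p : ℂ) • ρ) *ᵥ v) + star v ⬝ᵥ (((q : ℂ) • ρ') *ᵥ v) = 0 := by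
      rw [← dotProduct_add, ← add_mulVec, ← hω, hv, dotProduct_zero]
    obtain ⟨e1, e2⟩ := (add_eq_zero_iff_of_nonneg (h1.dotProduct_mulVec_nonneg v)
      (h2.dotProduct_mulVec_nonneg v)).mp e
    rw [h1.dotProduct_mulVec_zero_iff, smul_mulVec] at e1
    rw [h2.dotProduct_mulVec_zero_iff, smul_mulVec] at e2
    exact ⟨(smul_eq_zero.mp e1).resolve_left hpc.ne', (smul_eq_zero.mp e2).resolve_left hqc.ne'⟩
  have n1 := (relEnt_integral_formula hρ hωpos htr1 fun v hv => (hker v hv).1).1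
  have n2 := (relEnt_integral_formula hρ' hωpos (htr ▸ htr1) fun v hv => (hker v hv).2).1
  have key : p * relEnt ρ σ + q * relEnt ρ' σ - relEnt ω σ =
      p * relEnt ρ ω + q * relEnt ρ' ω := by
    have e : relEnt ω σ = ((ω * hermLog2 ω).trace).re - ((ω * hermLog2 σ).trace).re := by
      rw [relEnt, Matrix.mul_sub, trace_sub, Complex.sub_re]
    have e' : ∀ L, ((ω * L).trace).re = p * ((ρ * L).trace).re + q * ((ρ' * L).trace).re := by
      intro L
      rw [hω, Matrix.add_mul, Matrix.smul_mul, Matrix.smul_mul, trace_add, trace_smul, trace_smul]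
      simp
    rw [e, e', e']
    simp only [relEnt, Matrix.mul_sub, trace_sub, Complex.sub_re]
    ring
  have := mul_nonneg hp0.le n1
  have := mul_nonneg hq0.le n2
  linarith

end Monotonicity

section Tensor

open scoped Kronecker

lemma tensorBip_eq_kronecker {ι₁ κ₁ ι₂ κ₂ : Type*} (A : Matrix (ι₁ × κ₁) (ι₁ × κ₁) ℂ)
    (B : Matrix (ι₂ × κ₂) (ι₂ × κ₂) ℂ) :
    tensorBip A B = (A ⊗ₖ B).submatrix (Equiv.prodProdProdComm ι₁ ι₂ κ₁ κ₂)
      (Equiv.prodProdProdComm ι₁ ι₂ κ₁ κ₂) := rfl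

lemma tensorBip_conjTranspose {ι₁ κ₁ ι₂ κ₂ : Type*} (A : Matrix (ι₁ × κ₁) (ι₁ × κ₁) ℂ)
    (B : Matrix (ι₂ × κ₂) (ι₂ × κ₂) ℂ) : (tensorBip A B)ᴴ = tensorBip Aᴴ Bᴴ := by
  ext x y
  simp [tensorBip, conjTranspose_apply]

lemma tensorBip_diagonal {ι₁ κ₁ ι₂ κ₂ : Type*} [DecidableEq ι₁] [DecidableEq κ₁]
    [DecidableEq ι₂] [DecidableEq κ₂] (d : ι₁ × κ₁ → ℝ) (d' : ι₂ × κ₂ → ℝ) :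
    tensorBip (diagonal fun i => ((d i : ℝ) : ℂ)) (diagonal fun i => ((d' i : ℝ) : ℂ)) =
      diagonal fun x => ((d (x.1.1, x.2.1) * d' (x.1.2, x.2.2) : ℝ) : ℂ) := by
  rw [tensorBip_eq_kronecker, diagonal_kronecker_diagonal, submatrix_diagonal_equiv]
  congr 1
  ext x
  simp

lemma ptrans_tensorBip {ι₁ κ₁ ι₂ κ₂ : Type*} (A : Matrix (ι₁ × κ₁) (ι₁ × κ₁) ℂ)
    (B : Matrix (ι₂ × κ₂) (ι₂ × κ₂) ℂ) :
    ptrans (tensorBip A B) = tensorBip (ptrans A) (ptrans B) := rfl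

lemma ptrans_isHermitian {ι κ : Type*} {A : Matrix (ι × κ) (ι × κ) ℂ} (hA : A.IsHermitian) :
    (ptrans A).IsHermitian := by
  ext x y
  exact hA.apply _ _

lemma trace_ptrans {ι κ : Type*} [Fintype ι] [Fintype κ] (A : Matrix (ι × κ) (ι × κ) ℂ) :
    (ptrans A).trace = A.trace := rfl

/-- Partial transpose as a linear map. -/
def ptransLin {ι κ : Type*} : Matrix (ι × κ) (ι × κ) ℂ →ₗ[ℂ] Matrix (ι × κ) (ι × κ) ℂ where
  toFun := ptrans
  map_add' _ _ := rfl
  map_smul' _ _ := rfl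

variable {ι₁ κ₁ ι₂ κ₂ : Type*} [Fintype ι₁] [Fintype κ₁] [Fintype ι₂] [Fintype κ₂]

lemma tensorBip_mul (A C : Matrix (ι₁ × κ₁) (ι₁ × κ₁) ℂ) (B D : Matrix (ι₂ × κ₂) (ι₂ × κ₂) ℂ) :
    tensorBip A B * tensorBip C D = tensorBip (A * C) (B * D) := by
  rw [tensorBip_eq_kronecker, tensorBip_eq_kronecker, tensorBip_eq_kronecker,
    submatrix_mul_equiv, mul_kronecker_mul]

lemma sum_regroup (f : ι₁ × κ₁ → ι₂ × κ₂ → ℝ) :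
    ∑ x : (ι₁ × ι₂) × (κ₁ × κ₂), f (x.1.1, x.2.1) (x.1.2, x.2.2) = ∑ y, ∑ z, f y z := by
  rw [← Fintype.sum_prod_type']
  exact Fintype.sum_equiv (Equiv.prodProdProdComm ι₁ ι₂ κ₁ κ₂) _ _ fun x => rfl

lemma sum_logb_mul {n m : Type*} [Fintype n] [Fintype m] {b α : n → ℝ} {b' α' : m → ℝ}
    (h : ∀ i, b i = 0 → α i = 0) (h' : ∀ i, b' i = 0 → α' i = 0)
    (hs : ∑ i, α i = 1) (hs' : ∑ i, α' i = 1) :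
    ∑ i, ∑ j, Real.logb 2 (b i * b' j) * (α i * α' j) =
      ∑ i, Real.logb 2 (b i) * α i + ∑ j, Real.logb 2 (b' j) * α' j := by
  have e : ∀ i j, Real.logb 2 (b i * b' j) * (α i * α' j) =
      Real.logb 2 (b i) * α i * α' j + α i * (Real.logb 2 (b' j) * α' j) := by
    intro i j
    by_cases hi : b i = 0
    · simp [h i hi]
    by_cases hj : b' j = 0
    · simp [h' j hj]
    rw [Real.logb_mul hi hj]
    ring
  simp_rw [e, Finset.sum_add_distrib, ← Finset.mul_sum, ← Finset.sum_mul, hs, hs']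
  ring

variable [DecidableEq ι₁] [DecidableEq κ₁] [DecidableEq ι₂] [DecidableEq κ₂]

lemma tensorBip_conjDiag (U : Matrix (ι₁ × κ₁) (ι₁ × κ₁) ℂ) (V : Matrix (ι₂ × κ₂) (ι₂ × κ₂) ℂ)
    (d : ι₁ × κ₁ → ℝ) (d' : ι₂ × κ₂ → ℝ) :
    tensorBip (conjDiag U d) (conjDiag V d') =
      conjDiag (tensorBip U V) fun x => d (x.1.1, x.2.1) * d' (x.1.2, x.2.2) := by
  unfold conjDiag
  rw [← tensorBip_diagonal, tensorBip_conjTranspose, tensorBip_mul, tensorBip_mul]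

lemma tensorBip_unitary {U : Matrix (ι₁ × κ₁) (ι₁ × κ₁) ℂ} {V : Matrix (ι₂ × κ₂) (ι₂ × κ₂) ℂ}
    (hU : Uᴴ * U = 1) (hV : Vᴴ * V = 1) : (tensorBip U V)ᴴ * tensorBip U V = 1 := by
  rw [tensorBip_conjTranspose, tensorBip_mul, hU, hV, tensorBip_eq_kronecker, one_kronecker_one,
    submatrix_one_equiv]

lemma traceAbs_tensorBip {A : Matrix (ι₁ × κ₁) (ι₁ × κ₁) ℂ} {B : Matrix (ι₂ × κ₂) (ι₂ × κ₂) ℂ}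
    (hA : A.IsHermitian) (hB : B.IsHermitian) :
    traceAbs (tensorBip A B) = traceAbs A * traceAbs B := by
  obtain ⟨U, d, hU, rfl⟩ := exists_eq_conjDiag hA
  obtain ⟨V, d', hV, rfl⟩ := exists_eq_conjDiag hB
  rw [tensorBip_conjDiag, traceAbs_conjDiag (tensorBip_unitary hU hV), traceAbs_conjDiag hU,
    traceAbs_conjDiag hV, sum_regroup (fun y z => |d y * d' z|), Finset.sum_mul_sum]
  simp_rw [abs_mul]

lemma relEnt_tensorBip {ρ σ : Matrix (ι₁ × κ₁) (ι₁ × κ₁) ℂ} {ρ' σ' : Matrix (ι₂ × κ₂) (ι₂ × κ₂) ℂ}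
    (hρ : ρ.PosSemidef) (hρtr : ρ.trace = 1) (hσ : σ.PosSemidef)
    (hker : ∀ v, σ *ᵥ v = 0 → ρ *ᵥ v = 0)
    (hρ' : ρ'.PosSemidef) (hρtr' : ρ'.trace = 1) (hσ' : σ'.PosSemidef)
    (hker' : ∀ v, σ' *ᵥ v = 0 → ρ' *ᵥ v = 0) :
    relEnt (tensorBip ρ ρ') (tensorBip σ σ') = relEnt ρ σ + relEnt ρ' σ' := by
  obtain ⟨U, a, hU, rfl⟩ := exists_eq_conjDiag hρ.1
  obtain ⟨V, b, hV, rfl⟩ := exists_eq_conjDiag hσ.1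
  obtain ⟨U', a', hU', rfl⟩ := exists_eq_conjDiag hρ'.1
  obtain ⟨V', b', hV', rfl⟩ := exists_eq_conjDiag hσ'.1
  have hdiag : ∀ x, (((tensorBip V V')ᴴ * tensorBip (conjDiag U a) (conjDiag U' a') *
      tensorBip V V') x x).re = ((Vᴴ * conjDiag U a * V) (x.1.1, x.2.1) (x.1.1, x.2.1)).re *
        ((V'ᴴ * conjDiag U' a' * V') (x.1.2, x.2.2) (x.1.2, x.2.2)).re := by
    intro x
    rw [tensorBip_conjTranspose, tensorBip_mul, tensorBip_mul]
    have h := (isHermitian_conjTranspose_mul_mul V hρ.1).coe_re_apply_self (x.1.1, x.2.1)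
    have him : ((Vᴴ * conjDiag U a * V) (x.1.1, x.2.1) (x.1.1, x.2.1)).im = 0 := by
      rw [← h]
      exact Complex.ofReal_im _
    simp [tensorBip, Complex.mul_re, him]
  have ha : ∑ i, a i = 1 := by
    have := trace_conjDiag hU a
    rw [hρtr] at this
    exact_mod_cast this.symm
  have ha' : ∑ i, a' i = 1 := by
    have := trace_conjDiag hU' a'
    rw [hρtr'] at this
    exact_mod_cast this.symm
  have hα : ∑ i, ((Vᴴ * conjDiag U a * V) i i).re = 1 := by
    rw [trace_conj_eq hV, hρtr, Complex.one_re]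
  have hα' : ∑ i, ((V'ᴴ * conjDiag U' a' * V') i i).re = 1 := by
    rw [trace_conj_eq hV', hρtr', Complex.one_re]
  rw [tensorBip_conjDiag U, tensorBip_conjDiag V,
    relEnt_conjDiag (tensorBip_unitary hU hU') (tensorBip_unitary hV hV'), relEnt_conjDiag hU hV,
    relEnt_conjDiag hU' hV', ← tensorBip_conjDiag]
  simp_rw [hdiag]
  rw [sum_regroup fun y z => Real.logb 2 (a y * a' z) * (a y * a' z),
    sum_regroup fun y z => Real.logb 2 (b y * b' z) *
      (((Vᴴ * conjDiag U a * V) y y).re * ((V'ᴴ * conjDiag U' a' * V') z z).re),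
    sum_logb_mul (fun _ h => h) (fun _ h => h) ha ha',
    sum_logb_mul (fun i hi => by rw [conj_diag_eq_zero hV hker hi, Complex.zero_re])
      (fun i hi => by rw [conj_diag_eq_zero hV' hker' hi, Complex.zero_re]) hα hα']
  ring

end Tensor

/-- Properties of `B(ρ,σ) := S(ρ‖σ) + log₂ Tr|σ^Γ|`: monotonicity under
trace-preserving maps `Ψ` with `Ψ, Ψ^Γ` positive, convexity in `ρ`, and additivity
under tensor products. -/
theorem B_monotone_convex_additive {a b c e : ℕ}
    (ρ σ : Matrix (Fin a × Fin b) (Fin a × Fin b) ℂ)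
    (hρ : ρ.PosSemidef) (hρtr : ρ.trace = 1)
    (hσ : σ.PosSemidef) (hσtr : σ.trace = 1)
    (hsupp : ∀ v : (Fin a × Fin b) → ℂ, σ *ᵥ v = 0 → ρ *ᵥ v = 0) :
    (∀ Ψ : Matrix (Fin a × Fin b) (Fin a × Fin b) ℂ →ₗ[ℂ]
        Matrix (Fin c × Fin e) (Fin c × Fin e) ℂ,
      (∀ M, (Ψ M).trace = M.trace) →
      (∀ M, M.PosSemidef → (Ψ M).PosSemidef) →
      (∀ M, M.PosSemidef → (ptrans (Ψ (ptrans M))).PosSemidef) →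
      relEnt (Ψ ρ) (Ψ σ) + Real.logb 2 (traceAbs (ptrans (Ψ σ))) ≤
        relEnt ρ σ + Real.logb 2 (traceAbs (ptrans σ))) ∧
    (∀ ρ' : Matrix (Fin a × Fin b) (Fin a × Fin b) ℂ,
      ρ'.PosSemidef → ρ'.trace = 1 →
      (∀ v : (Fin a × Fin b) → ℂ, σ *ᵥ v = 0 → ρ' *ᵥ v = 0) →
      ∀ p : ℝ, 0 < p → p < 1 →
      relEnt (((p : ℝ) : ℂ) • ρ + (((1 - p : ℝ)) : ℂ) • ρ') σ +
          Real.logb 2 (traceAbs (ptrans σ)) ≤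
        p * (relEnt ρ σ + Real.logb 2 (traceAbs (ptrans σ))) +
          (1 - p) * (relEnt ρ' σ + Real.logb 2 (traceAbs (ptrans σ)))) ∧
    (∀ ρ' σ' : Matrix (Fin c × Fin e) (Fin c × Fin e) ℂ,
      ρ'.PosSemidef → ρ'.trace = 1 → σ'.PosSemidef → σ'.trace = 1 →
      (∀ v : (Fin c × Fin e) → ℂ, σ' *ᵥ v = 0 → ρ' *ᵥ v = 0) →
      relEnt (tensorBip ρ ρ') (tensorBip σ σ') +
          Real.logb 2 (traceAbs (ptrans (tensorBip σ σ'))) =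
        (relEnt ρ σ + Real.logb 2 (traceAbs (ptrans σ))) +
          (relEnt ρ' σ' + Real.logb 2 (traceAbs (ptrans σ')))) := by
  have one_le : ∀ {m n : ℕ} {τ : Matrix (Fin m × Fin n) (Fin m × Fin n) ℂ}, τ.PosSemidef →
      τ.trace = 1 → 1 ≤ traceAbs (ptrans τ) := by
    intro m n τ hτ htr
    have h := le_traceAbs (ptrans_isHermitian hτ.1)
    rwa [trace_ptrans, htr, Complex.one_re] at h
  refine ⟨fun Ψ htr hpos hposΓ => ?_, fun ρ' hρ' hρ'tr hsupp' p hp0 hp1 => ?_,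
    fun ρ' σ' hρ' hρ'tr hσ' hσ'tr hsupp' => ?_⟩
  · refine add_le_add (relEnt_map_le htr hpos hρ hσ (hρtr.trans hσtr.symm) hsupp)
      (Real.logb_le_logb_of_le one_lt_two ?_ ?_)
    · exact one_pos.trans_le (one_le (hpos σ hσ) ((htr σ).trans hσtr))
    · exact traceAbs_map_le (Ψ := ptransLin ∘ₗ Ψ ∘ₗ ptransLin) (fun M => htr (ptrans M)) hposΓ
        (ptrans_isHermitian hσ.1)
  · have h := relEnt_convex σ hρ hρ' (hρtr.trans hρ'tr.symm) hp0 hp1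
    linarith
  · have h1 := one_le hσ hσtr
    have h2 := one_le hσ' hσ'tr
    rw [relEnt_tensorBip hρ hρtr hσ hsupp hρ' hρ'tr hσ' hsupp', ptrans_tensorBip,
      traceAbs_tensorBip (ptrans_isHermitian hσ.1) (ptrans_isHermitian hσ'.1),
      Real.logb_mul (by positivity) (by positivity)]
    ring
end
end

section
/- Let d > 2 be an integer and 0 ≤ p ≤ 1. Then the p.p.t. distillable entanglement of the Werner state satisfies D_Γ(W_d(p)) ≤ 0 if 0 ≤ p ≤ 1/2; D_Γ(W_d(p)) ≤ 1 + p·log₂ p + (1−p)·log₂(1−p) if 1/2 ≤ p ≤ 1/2 + 1/d; and D_Γ(W_d(p)) ≤ log₂((d−2)/d) + p·log₂((d+2)/(d−2)) if 1/2 + 1/d ≤ p ≤ 1. -/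
open Matrix Filter
open scoped ComplexOrder

noncomputable section

/-- `n`-fold tensor power of a bipartite matrix, regrouped as a bipartite matrix. -/
def tpow {ι κ : Type*} (ρ : Matrix (ι × κ) (ι × κ) ℂ) (n : ℕ) :
    Matrix ((Fin n → ι) × (Fin n → κ)) ((Fin n → ι) × (Fin n → κ)) ℂ :=
  fun x y => ∏ i, ρ (x.1 i, x.2 i) (y.1 i, y.2 i)

/-- p.p.t. distillable entanglement. -/
def DGamma {ι κ : Type*} [Fintype ι] [Fintype κ] [DecidableEq ι] [DecidableEq κ]
    (ρ : Matrix (ι × κ) (ι × κ) ℂ) : ℝ :=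
  sSup {r : ℝ | 0 ≤ r ∧
    Tendsto (fun n : ℕ => FGamma (tpow ρ n) ((⌊(2 : ℝ) ^ (r * (n : ℝ))⌋ : ℤ) : ℝ))
      atTop (nhds 1)}

/-- The maximally entangled state `Φ(d) = (1/d) ∑ |ii⟩⟨jj|`. -/
def maxEnt (d : ℕ) : Matrix (Fin d × Fin d) (Fin d × Fin d) ℂ :=
  fun x y => if x.1 = x.2 ∧ y.1 = y.2 then (1 / (d : ℂ)) else 0

/-- The Werner state `W_d(p) = ((1-p)/(d²+d))(1+T) + (p/(d²-d))(1-T)` where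
`T = d Φ(d)^Γ` is the swap operator. -/
def werner (d : ℕ) (p : ℝ) : Matrix (Fin d × Fin d) (Fin d × Fin d) ℂ :=
  (((1 - p) / ((d : ℝ) ^ 2 + d) : ℝ) : ℂ) • (1 + (d : ℂ) • ptrans (maxEnt d)) +
    ((p / ((d : ℝ) ^ 2 - d) : ℝ) : ℂ) • (1 - (d : ℂ) • ptrans (maxEnt d))

/-- Tensor product of a family of bipartite matrices, regrouped as a bipartite matrix. -/
def tens {ι κ : Type*} {n : ℕ} (f : Fin n → Matrix (ι × κ) (ι × κ) ℂ) :
    Matrix ((Fin n → ι) × (Fin n → κ)) ((Fin n → ι) × (Fin n → κ)) ℂ :=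
  fun x y => ∏ i, f i (x.1 i, x.2 i) (y.1 i, y.2 i)

open scoped MatrixOrder Matrix.Norms.L2Operator in
lemma exists_eq_conjTranspose_mul_self {m : Type*} [Fintype m] {A : Matrix m m ℂ}
    (hA : A.PosSemidef) : ∃ B : Matrix m m ℂ, A = Bᴴ * B := by
  classical
  exact CStarAlgebra.nonneg_iff_eq_star_mul_self.mp hA.nonneg

section Tensor

variable {ι κ : Type*} {n : ℕ}

lemma trace_tens [Fintype ι] [Fintype κ] (f : Fin n → Matrix (ι × κ) (ι × κ) ℂ) :
    (tens f).trace = ∏ i, (f i).trace := by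
  simp only [Matrix.trace, Matrix.diag]
  rw [Fintype.prod_sum,
    ← (Equiv.arrowProdEquivProdArrow (Fin n) (fun _ => ι) (fun _ => κ)).sum_comp]
  rfl

lemma tens_mul [Fintype ι] [Fintype κ] (f g : Fin n → Matrix (ι × κ) (ι × κ) ℂ) :
    tens f * tens g = tens fun i => f i * g i := by
  ext x y
  simp only [tens, Matrix.mul_apply]
  rw [Fintype.prod_sum,
    ← (Equiv.arrowProdEquivProdArrow (Fin n) (fun _ => ι) (fun _ => κ)).sum_comp]
  exact Finset.sum_congr rfl fun z _ => Finset.prod_mul_distrib.symm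

lemma conjTranspose_tens (f : Fin n → Matrix (ι × κ) (ι × κ) ℂ) :
    (tens f)ᴴ = tens fun i => (f i)ᴴ := by
  ext x y
  simp [tens, Matrix.conjTranspose_apply]

lemma ptrans_tpow (A : Matrix (ι × κ) (ι × κ) ℂ) :
    ptrans (tpow A n) = tpow (ptrans A) n := rfl

lemma posSemidef_tens [Fintype ι] [Fintype κ] {f : Fin n → Matrix (ι × κ) (ι × κ) ℂ}
    (hf : ∀ i, (f i).PosSemidef) : (tens f).PosSemidef := by
  choose B hB using fun i => exists_eq_conjTranspose_mul_self (hf i)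
  have : tens f = (tens B)ᴴ * tens B := by
    rw [conjTranspose_tens, tens_mul]
    congr 1
    funext i
    exact hB i
  rw [this]
  exact Matrix.posSemidef_conjTranspose_mul_self _

lemma tpow_sum {J : Type*} [Fintype J] (c : J → ℝ) (E : J → Matrix (ι × κ) (ι × κ) ℂ) :
    tpow (∑ j, (c j : ℂ) • E j) n =
      ∑ s : Fin n → J, ((∏ i, c (s i) : ℝ) : ℂ) • tens fun i => E (s i) := by
  ext x y
  simp only [tpow, tens, Matrix.sum_apply, Matrix.smul_apply, smul_eq_mul]
  rw [Fintype.prod_sum]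
  simp [Finset.prod_mul_distrib]

lemma re_trace_mul_tpow_sum [Fintype ι] [Fintype κ] {J : Type*} [Fintype J] (c : J → ℝ)
    (E : J → Matrix (ι × κ) (ι × κ) ℂ)
    (F : Matrix ((Fin n → ι) × (Fin n → κ)) ((Fin n → ι) × (Fin n → κ)) ℂ) :
    (F * tpow (∑ j, (c j : ℂ) • E j) n).trace.re =
      ∑ s : Fin n → J, (∏ i, c (s i)) * (F * tens fun i => E (s i)).trace.re := by
  rw [tpow_sum, Matrix.mul_sum, Matrix.trace_sum, Complex.re_sum]
  refine Finset.sum_congr rfl fun s _ => ?_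
  rw [Matrix.mul_smul, Matrix.trace_smul, smul_eq_mul, Complex.re_ofReal_mul]

end Tensor

lemma re_trace_mul_nonneg {m : Type*} [Fintype m] {A E : Matrix m m ℂ}
    (hA : A.PosSemidef) (hE : E.PosSemidef) : 0 ≤ (A * E).trace.re := by
  obtain ⟨B, rfl⟩ := exists_eq_conjTranspose_mul_self hE
  have h := (hA.mul_mul_conjTranspose_same B).trace_nonneg
  rw [Matrix.trace_mul_cycle, Matrix.trace_mul_comm] at h
  exact (Complex.le_def.mp h).1

lemma trace_ptrans_mul_ptrans {ι κ : Type*} [Fintype ι] [Fintype κ]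
    (A B : Matrix (ι × κ) (ι × κ) ℂ) :
    (ptrans A * ptrans B).trace = (A * B).trace := by
  simp only [Matrix.trace, Matrix.diag, Matrix.mul_apply, ptrans, Fintype.sum_prod_type]
  refine Finset.sum_congr rfl fun i _ => ?_
  conv_lhs => enter [2, j]; rw [Finset.sum_comm]
  conv_rhs => enter [2, j]; rw [Finset.sum_comm]
  exact Finset.sum_comm

/-- Let `ρ = ∑ w_j E_j` and `σ = ∑ (w_j / c_j) E_j` be combinations of states `E_j`, with
`σ^Γ = ∑ u_l G_l` a combination of states `G_l`. Then the fidelity of distillation from `ρ^{⊗n}`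
is bounded in terms of `∑ |u_l|` and the Rényi-type weight `∑ w_j c_j ^ lam`. -/
lemma FGamma_tpow_le {ι κ : Type*} [Fintype ι] [Fintype κ] [DecidableEq ι] [DecidableEq κ]
    {J L : Type*} [Fintype J] [Fintype L] (E : J → Matrix (ι × κ) (ι × κ) ℂ)
    (G : L → Matrix (ι × κ) (ι × κ) ℂ)
    (hE : ∀ j, (E j).PosSemidef) (hEt : ∀ j, (E j).trace = 1)
    (hG : ∀ j, (G j).PosSemidef) (hGt : ∀ j, (G j).trace = 1)
    (w c : J → ℝ) (u : L → ℝ) (hw : ∀ j, 0 ≤ w j) (hc : ∀ j, 0 < c j)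
    (hu : ptrans (∑ j, ((w j / c j : ℝ) : ℂ) • E j) = ∑ l, (u l : ℂ) • G l)
    {K t lam : ℝ} (hK : 0 < K) (ht : 0 < t) (hlam : 0 < lam) (n : ℕ) :
    FGamma (tpow (∑ j, (w j : ℂ) • E j) n) K ≤
      t * ((∑ l, |u l|) ^ n / K) + t ^ (-lam) * (∑ j, w j * c j ^ lam) ^ n := by
  refine Real.sSup_le ?_ ?_
  · rintro x ⟨F, hF, hF', hFK, hFK', rfl⟩
    have hEs : ∀ s : Fin n → J, (tens fun i => E (s i)).PosSemidef :=
      fun s => posSemidef_tens fun i => hE _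
    have hGs : ∀ s : Fin n → L, (tens fun i => G (s i)).PosSemidef :=
      fun s => posSemidef_tens fun i => hG _
    have f0 : ∀ s : Fin n → J, 0 ≤ (F * tens fun i => E (s i)).trace.re :=
      fun s => re_trace_mul_nonneg hF (hEs s)
    have f1 : ∀ s : Fin n → J, (F * tens fun i => E (s i)).trace.re ≤ 1 := fun s => by
      have h := re_trace_mul_nonneg hF' (hEs s)
      rw [Matrix.sub_mul, Matrix.one_mul, Matrix.trace_sub, trace_tens] at h
      simp only [hEt, Finset.prod_const_one, Complex.sub_re, Complex.one_re] at h
      linarith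
    have g1 : ∀ s : Fin n → L, |(ptrans F * tens fun i => G (s i)).trace.re| ≤ 1 / K :=
      fun s => by
      have h := re_trace_mul_nonneg hFK (hGs s)
      have h' := re_trace_mul_nonneg hFK' (hGs s)
      rw [Matrix.sub_mul, Matrix.smul_mul, Matrix.one_mul, Matrix.trace_sub, Matrix.trace_smul,
        trace_tens, smul_eq_mul, Complex.sub_re, Complex.re_ofReal_mul] at h
      rw [Matrix.add_mul, Matrix.smul_mul, Matrix.one_mul, Matrix.trace_add, Matrix.trace_smul,
        trace_tens, smul_eq_mul, Complex.add_re, Complex.re_ofReal_mul] at h'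
      simp only [hGt, Finset.prod_const_one, Complex.one_re, mul_one] at h h'
      exact abs_le.mpr ⟨by linarith, by linarith⟩
    have hσ : (F * tpow (∑ j, ((w j / c j : ℝ) : ℂ) • E j) n).trace.re ≤
        (∑ l, |u l|) ^ n / K := by
      rw [← trace_ptrans_mul_ptrans, ptrans_tpow, hu, re_trace_mul_tpow_sum, Fintype.sum_pow,
        Finset.sum_div]
      refine Finset.sum_le_sum fun s _ => (le_abs_self _).trans ?_
      rw [abs_mul, Finset.abs_prod, div_eq_mul_one_div]
      exact mul_le_mul_of_nonneg_left (g1 s) (Finset.prod_nonneg fun i _ => abs_nonneg _)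
    have hρ : (F * tpow (∑ j, (w j : ℂ) • E j) n).trace.re ≤
        t * (F * tpow (∑ j, ((w j / c j : ℝ) : ℂ) • E j) n).trace.re +
          t ^ (-lam) * (∑ j, w j * c j ^ lam) ^ n := by
      rw [re_trace_mul_tpow_sum, re_trace_mul_tpow_sum, Fintype.sum_pow, Finset.mul_sum,
        Finset.mul_sum, ← Finset.sum_add_distrib]
      refine Finset.sum_le_sum fun s _ => ?_
      rw [Finset.prod_div_distrib, Finset.prod_mul_distrib,
        Real.finsetProd_rpow _ _ fun i _ => (hc _).le]
      have hW : 0 ≤ ∏ i, w (s i) := Finset.prod_nonneg fun i _ => hw _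
      have hC : 0 < ∏ i, c (s i) := Finset.prod_pos fun i _ => hc _
      set W := ∏ i, w (s i)
      set C := ∏ i, c (s i)
      set f := (F * tens fun i => E (s i)).trace.re
      have hf0 : 0 ≤ f := f0 s
      have hf1 : f ≤ 1 := f1 s
      rw [Real.rpow_neg ht.le]
      rcases le_total C t with h | h
      · have h1 : W ≤ t * (W / C) := by
          rw [mul_div_assoc', le_div_iff₀ hC]
          nlinarith
        have h2 : 0 ≤ (t ^ lam)⁻¹ * (W * C ^ lam) := by positivity
        nlinarith
      · have h1 : W ≤ (t ^ lam)⁻¹ * (W * C ^ lam) := by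
          have h3 : t ^ lam ≤ C ^ lam := Real.rpow_le_rpow ht.le h hlam.le
          have h4 : 0 < t ^ lam := Real.rpow_pos_of_pos ht _
          rw [inv_mul_eq_div, le_div_iff₀ h4]
          nlinarith
        have h2 : 0 ≤ t * (W / C * f) := by positivity
        nlinarith
    calc _ ≤ _ := hρ
      _ ≤ _ := by gcongr
  · have : 0 ≤ ∑ j, w j * c j ^ lam :=
      Finset.sum_nonneg fun j _ => mul_nonneg (hw j) (Real.rpow_nonneg (hc j).le _)
    have : 0 ≤ ∑ l, |u l| := Finset.sum_nonneg fun l _ => abs_nonneg _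
    positivity

/-- If `s` exceeds the weighted mean of the `logb 2 (c j)`, then the weighted sum of the
`c j ^ lam` is below `2 ^ (lam * s)` for some positive `lam`. -/
lemma exists_sum_mul_rpow_lt {J : Type*} [Fintype J] (w c : J → ℝ) (hw : ∑ j, w j = 1)
    (hc : ∀ j, 0 < c j) {s : ℝ} (hs : ∑ j, w j * Real.logb 2 (c j) < s) :
    ∃ lam : ℝ, 0 < lam ∧ ∑ j, w j * c j ^ lam < 2 ^ (lam * s) := by
  have hd : HasDerivAt (fun lam : ℝ => (2 : ℝ) ^ (lam * s) - ∑ j, w j * c j ^ lam)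
      (Real.log 2 * s - ∑ j, w j * Real.log (c j)) 0 := by
    refine HasDerivAt.sub ?_ (HasDerivAt.fun_sum fun j _ => HasDerivAt.const_mul _ ?_)
    · have h := ((hasDerivAt_id (0 : ℝ)).mul_const s).const_rpow (a := 2) (by norm_num)
      simpa using h
    · have h := (hasDerivAt_id (0 : ℝ)).const_rpow (hc j)
      simpa using h
  have hpos : 0 < Real.log 2 * s - ∑ j, w j * Real.log (c j) := by
    have hl : 0 < Real.log 2 := Real.log_pos (by norm_num)
    have h := mul_lt_mul_of_pos_left hs hl
    rw [Finset.mul_sum] at h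
    have h2 : ∑ j, Real.log 2 * (w j * Real.logb 2 (c j)) = ∑ j, w j * Real.log (c j) :=
      Finset.sum_congr rfl fun j _ => by
        rw [Real.logb]
        field_simp
    linarith
  have h := hd.tendsto_slope_zero_right.eventually (lt_mem_nhds hpos)
  obtain ⟨lam, h1, h2⟩ := (h.and self_mem_nhdsWithin).exists
  refine ⟨lam, h2, ?_⟩
  have h3 : (0 : ℝ) < lam := h2
  simp only [zero_add, zero_mul, Real.rpow_zero, mul_one, hw, sub_self, sub_zero,
    smul_eq_mul] at h1
  have := (mul_pos_iff_of_pos_left (inv_pos.mpr h3)).mp h1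
  linarith

/-- A relative entropy bound on the p.p.t. distillable entanglement of `ρ = ∑ w_j E_j`, from the
comparison operator `σ = ∑ (w_j / c_j) E_j` with `σ^Γ = ∑ u_l G_l`. -/
lemma DGamma_le {ι κ : Type*} [Fintype ι] [Fintype κ] [DecidableEq ι] [DecidableEq κ]
    {J L : Type*} [Fintype J] [Fintype L] (E : J → Matrix (ι × κ) (ι × κ) ℂ)
    (G : L → Matrix (ι × κ) (ι × κ) ℂ)
    (hE : ∀ j, (E j).PosSemidef) (hEt : ∀ j, (E j).trace = 1)
    (hG : ∀ j, (G j).PosSemidef) (hGt : ∀ j, (G j).trace = 1)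
    (w c : J → ℝ) (u : L → ℝ) (hw : ∀ j, 0 ≤ w j) (hw1 : ∑ j, w j = 1) (hc : ∀ j, 0 < c j)
    (hu : ptrans (∑ j, ((w j / c j : ℝ) : ℂ) • E j) = ∑ l, (u l : ℂ) • G l)
    {M : ℝ} (hM : 0 < M) (huM : ∑ l, |u l| = M)
    (hB : 0 ≤ ∑ j, w j * Real.logb 2 (c j) + Real.logb 2 M) :
    DGamma (∑ j, (w j : ℂ) • E j) ≤ ∑ j, w j * Real.logb 2 (c j) + Real.logb 2 M := by
  refine Real.sSup_le ?_ hB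
  rintro r ⟨hr0, hr⟩
  by_contra! hlt
  obtain ⟨s, hs1, hs2⟩ := exists_between (lt_sub_iff_add_lt.mpr hlt)
  obtain ⟨lam, hlam, hlt⟩ := exists_sum_mul_rpow_lt w c hw1 hc hs1
  set V := ∑ j, w j * c j ^ lam with hV
  have hV0 : 0 ≤ V :=
    Finset.sum_nonneg fun j _ => mul_nonneg (hw j) (Real.rpow_nonneg (hc j).le _)
  have hq : (2 : ℝ) ^ s * M / 2 ^ r < 1 := by
    rw [div_lt_one (by positivity)]
    calc (2 : ℝ) ^ s * M = 2 ^ (s + Real.logb 2 M) := by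
          rw [Real.rpow_add (by norm_num), Real.rpow_logb (by norm_num) (by norm_num) hM]
      _ < 2 ^ r := Real.rpow_lt_rpow_of_exponent_lt (by norm_num) (by linarith)
  have hq' : V / 2 ^ (lam * s) < 1 := by rwa [div_lt_one (by positivity)]
  have hlim : Tendsto (fun n : ℕ => 2 * ((2 : ℝ) ^ s * M / 2 ^ r) ^ n +
      (V / 2 ^ (lam * s)) ^ n) atTop (nhds 0) := by
    have h1 := tendsto_pow_atTop_nhds_zero_of_lt_one (by positivity) hq
    have h2 := tendsto_pow_atTop_nhds_zero_of_lt_one (by positivity) hq'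
    simpa using (h1.const_mul 2).add h2
  refine absurd (le_of_tendsto_of_tendsto' hr hlim fun n => ?_) (by norm_num)
  have hx : (1 : ℝ) ≤ 2 ^ (r * n) := Real.one_le_rpow (by norm_num) (by positivity)
  have hfl : (2 : ℝ) ^ (r * n) / 2 ≤ (⌊(2 : ℝ) ^ (r * n)⌋ : ℤ) := by
    have h1 := Int.lt_floor_add_one ((2 : ℝ) ^ (r * n))
    have h2 : (1 : ℝ) ≤ (⌊(2 : ℝ) ^ (r * n)⌋ : ℤ) := by
      exact_mod_cast Int.le_floor.mpr (by exact_mod_cast hx)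
    linarith
  have hK : (0 : ℝ) < (⌊(2 : ℝ) ^ (r * n)⌋ : ℤ) := by linarith
  refine (FGamma_tpow_le E G hE hEt hG hGt w c u hw hc hu hK
    (t := (2 : ℝ) ^ (s * n)) (by positivity) hlam n).trans ?_
  rw [huM, ← hV]
  have e1 : (2 : ℝ) ^ (s * n) * (M ^ n / (⌊(2 : ℝ) ^ (r * n)⌋ : ℤ)) ≤
      2 * ((2 : ℝ) ^ s * M / 2 ^ r) ^ n := by
    calc (2 : ℝ) ^ (s * n) * (M ^ n / (⌊(2 : ℝ) ^ (r * n)⌋ : ℤ))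
        ≤ (2 : ℝ) ^ (s * n) * (M ^ n / ((2 : ℝ) ^ (r * n) / 2)) := by gcongr
      _ = 2 * ((2 : ℝ) ^ s * M / 2 ^ r) ^ n := by
          rw [Real.rpow_mul_natCast (by norm_num), Real.rpow_mul_natCast (by norm_num),
            div_pow, mul_pow]
          field_simp
  have e2 : ((2 : ℝ) ^ (s * n)) ^ (-lam) * V ^ n = (V / 2 ^ (lam * s)) ^ n := by
    rw [← Real.rpow_mul (by norm_num), show s * (n : ℝ) * -lam = -(lam * s * n) by ring,
      Real.rpow_neg (by norm_num), Real.rpow_mul_natCast (by norm_num), div_pow]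
    field_simp
  linarith

/-- The swap operator. -/
def swapOp (d : ℕ) : Matrix (Fin d × Fin d) (Fin d × Fin d) ℂ :=
  fun x y => if x = y.swap then 1 else 0

lemma smul_ptrans_maxEnt {d : ℕ} (hd : d ≠ 0) : (d : ℂ) • ptrans (maxEnt d) = swapOp d := by
  have hd' : (d : ℂ) ≠ 0 := by exact_mod_cast hd
  ext x y
  simp only [ptrans, maxEnt, swapOp, Matrix.smul_apply, smul_eq_mul, Prod.ext_iff, Prod.fst_swap,
    Prod.snd_swap, mul_ite, mul_zero, mul_one_div_cancel hd']
  congr 1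
  exact propext ⟨fun h => ⟨h.1, h.2.symm⟩, fun h => ⟨h.1, h.2.symm⟩⟩

lemma swapOp_mul_self (d : ℕ) : swapOp d * swapOp d = 1 := by
  ext x y
  simp [Matrix.mul_apply, swapOp, Matrix.one_apply]

lemma conjTranspose_swapOp (d : ℕ) : (swapOp d)ᴴ = swapOp d := by
  ext x y
  simp only [Matrix.conjTranspose_apply, swapOp, apply_ite star, star_one, star_zero]
  congr 1
  exact propext ⟨fun h => by simp [h], fun h => by simp [h]⟩

lemma trace_swapOp (d : ℕ) : (swapOp d).trace = d := by
  simp only [Matrix.trace, Matrix.diag, swapOp, Fintype.sum_prod_type, Prod.ext_iff,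
    Prod.fst_swap, Prod.snd_swap]
  have : ∀ a b : Fin d, (a = b ∧ b = a) ↔ a = b := fun a b => ⟨And.left, fun h => ⟨h, h.symm⟩⟩
  simp [this]

lemma ptrans_swapOp {d : ℕ} (hd : d ≠ 0) : ptrans (swapOp d) = (d : ℂ) • maxEnt d := by
  rw [← smul_ptrans_maxEnt hd]
  rfl

lemma posSemidef_one_add_swapOp (d : ℕ) : (1 + swapOp d).PosSemidef := by
  have h : 1 + swapOp d = (1 / 2 : ℂ) • ((1 + swapOp d)ᴴ * (1 + swapOp d)) := by
    rw [Matrix.conjTranspose_add, Matrix.conjTranspose_one, conjTranspose_swapOp,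
      Matrix.add_mul, Matrix.mul_add, Matrix.mul_add, swapOp_mul_self]
    simp only [Matrix.one_mul, Matrix.mul_one]
    module
  rw [h]
  exact (Matrix.posSemidef_conjTranspose_mul_self _).smul (by positivity)

lemma posSemidef_one_sub_swapOp (d : ℕ) : (1 - swapOp d).PosSemidef := by
  have h : 1 - swapOp d = (1 / 2 : ℂ) • ((1 - swapOp d)ᴴ * (1 - swapOp d)) := by
    rw [Matrix.conjTranspose_sub, Matrix.conjTranspose_one, conjTranspose_swapOp,
      Matrix.sub_mul, Matrix.mul_sub, Matrix.mul_sub, swapOp_mul_self]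
    simp only [Matrix.one_mul, Matrix.mul_one]
    module
  rw [h]
  exact (Matrix.posSemidef_conjTranspose_mul_self _).smul (by positivity)

lemma conjTranspose_maxEnt (d : ℕ) : (maxEnt d)ᴴ = maxEnt d := by
  ext x y
  simp only [Matrix.conjTranspose_apply, maxEnt, apply_ite star, star_zero, and_comm]
  simp

lemma maxEnt_mul_self {d : ℕ} (hd : d ≠ 0) : maxEnt d * maxEnt d = maxEnt d := by
  have hd' : (d : ℂ) ≠ 0 := by exact_mod_cast hd
  ext x y
  simp only [Matrix.mul_apply, maxEnt, Fintype.sum_prod_type, ite_and]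
  by_cases hx : x.1 = x.2 <;> by_cases hy : y.1 = y.2 <;> simp [hx, hy, hd']

lemma trace_maxEnt {d : ℕ} (hd : d ≠ 0) : (maxEnt d).trace = 1 := by
  have hd' : (d : ℂ) ≠ 0 := by exact_mod_cast hd
  simp [Matrix.trace, maxEnt, Fintype.sum_prod_type, hd']

lemma posSemidef_maxEnt {d : ℕ} (hd : d ≠ 0) : (maxEnt d).PosSemidef := by
  have h := Matrix.posSemidef_conjTranspose_mul_self (maxEnt d)
  rwa [conjTranspose_maxEnt, maxEnt_mul_self hd] at h

lemma posSemidef_one_sub_maxEnt {d : ℕ} (hd : d ≠ 0) : (1 - maxEnt d).PosSemidef := by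
  have h := Matrix.posSemidef_conjTranspose_mul_self (1 - maxEnt d)
  rwa [Matrix.conjTranspose_sub, Matrix.conjTranspose_one, conjTranspose_maxEnt, Matrix.sub_mul,
    Matrix.mul_sub, Matrix.mul_sub, maxEnt_mul_self hd, Matrix.one_mul, Matrix.mul_one,
    Matrix.one_mul, sub_self, sub_zero] at h

lemma ptrans_one {ι κ : Type*} [DecidableEq ι] [DecidableEq κ] :
    ptrans (1 : Matrix (ι × κ) (ι × κ) ℂ) = 1 := by
  ext x y
  simp only [ptrans, Matrix.one_apply, Prod.ext_iff, eq_comm (a := y.2)]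

/-- Comparing `W_d(p)` with the operator having weights `(1 - p) / b` and `p / a` on the symmetric
and antisymmetric states, whose partial transpose has trace norm `M`, bounds the p.p.t.
distillable entanglement of `W_d(p)`. -/
lemma DGamma_werner_le {d : ℕ} (hd : 2 < d) {p : ℝ} (hp₀ : 0 ≤ p) (hp₁ : p ≤ 1) {a b M : ℝ}
    (ha : 0 < a) (hb : 0 < b) (hM : 0 < M)
    (hMeq : |((1 - p) / b - p / a) / d| +
      ((1 - p) / b * (d - 1) + p / a * (d + 1)) / d = M)
    (hB : 0 ≤ p * Real.logb 2 a + (1 - p) * Real.logb 2 b + Real.logb 2 M) :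
    DGamma (werner d p) ≤ p * Real.logb 2 a + (1 - p) * Real.logb 2 b + Real.logb 2 M := by
  have hd0 : d ≠ 0 := by omega
  have hdR : (2 : ℝ) < d := by exact_mod_cast hd
  have hcast : ∀ x : ℝ, x ≠ 0 → (x : ℂ) ≠ 0 := fun x h => by exact_mod_cast h
  have h0 : (d : ℂ) ≠ 0 := by exact_mod_cast hd0
  have hm : (d : ℂ) - 1 ≠ 0 := by exact_mod_cast hcast (d - 1) (by linarith)
  have hp : (d : ℂ) + 1 ≠ 0 := by exact_mod_cast hcast (d + 1) (by linarith)
  have hs1 : (d : ℂ) ^ 2 + d ≠ 0 := by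
    rw [show (d : ℂ) ^ 2 + d = d * (d + 1) by ring]; exact mul_ne_zero h0 hp
  have hs2 : (d : ℂ) ^ 2 - d ≠ 0 := by
    rw [show (d : ℂ) ^ 2 - d = d * (d - 1) by ring]; exact mul_ne_zero h0 hm
  have hs3 : (d : ℂ) ^ 2 - 1 ≠ 0 := by
    rw [show (d : ℂ) ^ 2 - 1 = (d - 1) * (d + 1) by ring]; exact mul_ne_zero hm hp
  have hr1 : 0 ≤ (((d : ℝ) ^ 2 + d : ℝ)⁻¹) := by positivity
  have hr2 : 0 ≤ (((d : ℝ) ^ 2 - d : ℝ)⁻¹) := inv_nonneg.mpr (by nlinarith)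
  have hr3 : 0 ≤ (((d : ℝ) ^ 2 - 1 : ℝ)⁻¹) := inv_nonneg.mpr (by nlinarith)
  have hone : (1 : Matrix (Fin d × Fin d) (Fin d × Fin d) ℂ).trace = (d : ℂ) ^ 2 := by
    simp [Matrix.trace_one, sq]
  let E : Fin 2 → Matrix (Fin d × Fin d) (Fin d × Fin d) ℂ :=
    ![((((d : ℝ) ^ 2 + d)⁻¹ : ℝ) : ℂ) • (1 + swapOp d),
      ((((d : ℝ) ^ 2 - d)⁻¹ : ℝ) : ℂ) • (1 - swapOp d)]
  let G : Fin 2 → Matrix (Fin d × Fin d) (Fin d × Fin d) ℂ :=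
    ![maxEnt d, ((((d : ℝ) ^ 2 - 1)⁻¹ : ℝ) : ℂ) • (1 - maxEnt d)]
  let u : Fin 2 → ℝ := ![((1 - p) / b - p / a) / d,
    ((1 - p) / b * (d - 1) + p / a * (d + 1)) / d]
  have hW : werner d p = ∑ j, ((![1 - p, p] j : ℝ) : ℂ) • E j := by
    rw [werner, smul_ptrans_maxEnt hd0]
    simp only [E, Fin.sum_univ_two, Matrix.cons_val_zero, Matrix.cons_val_one, smul_smul,
      div_eq_mul_inv, Complex.ofReal_mul]
  have hL : p * Real.logb 2 a + (1 - p) * Real.logb 2 b =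
      ∑ j, ![1 - p, p] j * Real.logb 2 (![b, a] j) := by
    simp [Fin.sum_univ_two, add_comm]
  rw [hL] at hB ⊢
  rw [hW]
  refine DGamma_le E G ?_ ?_ ?_ ?_ _ _ u ?_ ?_ ?_ ?_ hM ?_ hB
  · refine Fin.forall_fin_two.mpr ⟨?_, ?_⟩
    · exact (posSemidef_one_add_swapOp d).smul (by exact_mod_cast hr1)
    · exact (posSemidef_one_sub_swapOp d).smul (by exact_mod_cast hr2)
  · refine Fin.forall_fin_two.mpr ⟨?_, ?_⟩
    · simp [E, Matrix.trace_add, trace_swapOp, hs1, hone, ← mul_add]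
    · simp [E, Matrix.trace_sub, trace_swapOp, hs2, hone]
  · refine Fin.forall_fin_two.mpr ⟨posSemidef_maxEnt hd0, ?_⟩
    exact (posSemidef_one_sub_maxEnt hd0).smul (by exact_mod_cast hr3)
  · refine Fin.forall_fin_two.mpr ⟨trace_maxEnt hd0, ?_⟩
    simp [G, Matrix.trace_sub, trace_maxEnt hd0, hs3, hone]
  · exact Fin.forall_fin_two.mpr ⟨sub_nonneg.mpr hp₁, hp₀⟩
  · simp [Fin.sum_univ_two]
  · exact Fin.forall_fin_two.mpr ⟨hb, ha⟩
  · have hpt : ∀ (x y : ℂ), ptrans (x • (1 + swapOp d) + y • (1 - swapOp d)) =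
        x • (1 + (d : ℂ) • maxEnt d) + y • (1 - (d : ℂ) • maxEnt d) := fun x y => by
      rw [← ptrans_swapOp hd0]
      conv_rhs => rw [← ptrans_one]
      rfl
    have ha' : (a : ℂ) ≠ 0 := hcast _ ha.ne'
    have hb' : (b : ℂ) ≠ 0 := hcast _ hb.ne'
    simp only [Fin.sum_univ_two, E, G, u, Matrix.cons_val_zero, Matrix.cons_val_one, smul_smul]
    rw [hpt]
    push_cast
    have e1 : ((d : ℂ) ^ 2 + d)⁻¹ = (d : ℂ)⁻¹ * ((d : ℂ) + 1)⁻¹ := by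
      rw [← mul_inv]; ring_nf
    have e2 : ((d : ℂ) ^ 2 - d)⁻¹ = (d : ℂ)⁻¹ * ((d : ℂ) - 1)⁻¹ := by
      rw [← mul_inv]; ring_nf
    have e3 : ((d : ℂ) ^ 2 - 1)⁻¹ = ((d : ℂ) - 1)⁻¹ * ((d : ℂ) + 1)⁻¹ := by
      rw [← mul_inv]; ring_nf
    rw [e1, e2, e3]
    match_scalars
    all_goals field_simp
    all_goals ring
  · have hnn : 0 ≤ ((1 - p) / b * (d - 1) + p / a * (d + 1)) / (d : ℝ) := by
      have h1 : 0 ≤ 1 - p := by linarith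
      have h2 : (0 : ℝ) ≤ d - 1 := by linarith
      positivity
    simp only [Fin.sum_univ_two, u, Matrix.cons_val_zero, Matrix.cons_val_one]
    rw [abs_of_nonneg hnn, hMeq]

/-- Upper bound on the p.p.t. distillable entanglement of Werner states. -/
theorem DGamma_werner_upper_bound (d : ℕ) (hd : 2 < d) (p : ℝ)
    (hp₀ : 0 ≤ p) (hp₁ : p ≤ 1) :
    (p ≤ 1 / 2 → DGamma (werner d p) ≤ 0) ∧
    (1 / 2 ≤ p → p ≤ 1 / 2 + 1 / (d : ℝ) →
      DGamma (werner d p) ≤ 1 + p * Real.logb 2 p + (1 - p) * Real.logb 2 (1 - p)) ∧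
    (1 / 2 + 1 / (d : ℝ) ≤ p →
      DGamma (werner d p) ≤
        Real.logb 2 (((d : ℝ) - 2) / (d : ℝ)) +
          p * Real.logb 2 (((d : ℝ) + 2) / ((d : ℝ) - 2))) := by
  have hdR : (2 : ℝ) < d := by exact_mod_cast hd
  have hd0 : (0 : ℝ) < d := by linarith
  refine ⟨fun hp => ?_, fun hp hp' => ?_, fun hp => ?_⟩
  · have h := DGamma_werner_le hd hp₀ hp₁ (a := 1) (b := 1) (M := 1) one_pos one_pos one_pos
      (by
        rw [abs_of_nonneg (div_nonneg (by linarith) hd0.le)]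
        field_simp
        ring)
      (by simp)
    simpa using h
  · have hp1 : p < 1 := by
      have : 1 / (d : ℝ) < 1 / 2 := one_div_lt_one_div_of_lt (by norm_num) hdR
      linarith
    have h0 : 0 < p := by linarith
    have h1 : 0 < 1 - p := by linarith
    have e : p * Real.logb 2 (2 * p) + (1 - p) * Real.logb 2 (2 * (1 - p)) + Real.logb 2 1 =
        1 + p * Real.logb 2 p + (1 - p) * Real.logb 2 (1 - p) := by
      rw [Real.logb_mul two_ne_zero h0.ne', Real.logb_mul two_ne_zero h1.ne', Real.logb_one,
        Real.logb_self_eq_one (by norm_num)]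
      ring
    rw [← e]
    refine DGamma_werner_le hd hp₀ hp₁ (by positivity) (by positivity) one_pos ?_ ?_
    · have e1 : (1 - p) / (2 * (1 - p)) = 1 / 2 := by field_simp
      have e2 : p / (2 * p) = 1 / 2 := by field_simp
      rw [e1, e2]
      field_simp
      norm_num
      ring
    · rw [e]
      have hb := Real.binEntropy_le_log_two (p := p)
      have hl : 0 < Real.log 2 := Real.log_pos (by norm_num)
      rw [Real.binEntropy, Real.log_inv, Real.log_inv] at hb
      have : 1 + p * Real.logb 2 p + (1 - p) * Real.logb 2 (1 - p) =
          (Real.log 2 + p * Real.log p + (1 - p) * Real.log (1 - p)) / Real.log 2 := by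
        simp only [Real.logb]
        field_simp
      rw [this]
      exact div_nonneg (by linarith) hl.le
  · have hm : 0 < (d : ℝ) - 2 := by linarith
    have hP : 0 < (d : ℝ) + 2 := by linarith
    have hc : 0 < (d : ℝ) + 2 - 4 * p := by linarith
    have hpd : (d : ℝ) + 2 ≤ 2 * p * d := by
      have := mul_le_mul_of_nonneg_right hp hd0.le
      field_simp at this
      linarith
    have e : p * Real.logb 2 ((d + 2 - 4 * p) / (d - 2)) +
        (1 - p) * Real.logb 2 ((d + 2 - 4 * p) / (d + 2)) +
        Real.logb 2 ((d - 2) * (d + 2) / (d * (d + 2 - 4 * p))) =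
        Real.logb 2 (((d : ℝ) - 2) / (d : ℝ)) +
          p * Real.logb 2 (((d : ℝ) + 2) / ((d : ℝ) - 2)) := by
      rw [Real.logb_div hc.ne' hm.ne', Real.logb_div hc.ne' hP.ne',
        Real.logb_div (by positivity) (by positivity), Real.logb_mul hm.ne' hP.ne',
        Real.logb_mul hd0.ne' hc.ne', Real.logb_div hm.ne' hd0.ne', Real.logb_div hP.ne' hm.ne']
      ring
    rw [← e]
    refine DGamma_werner_le hd hp₀ hp₁ (by positivity) (by positivity) (by positivity) ?_ ?_
    · rw [abs_of_nonpos]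
      · field_simp
        ring
      · refine div_nonpos_of_nonpos_of_nonneg ?_ hd0.le
        rw [sub_nonpos, div_div_eq_mul_div, div_div_eq_mul_div]
        rw [div_le_div_iff_of_pos_right hc]
        linarith
    · rw [e]
      have hl : 0 < Real.log 2 := Real.log_pos (by norm_num)
      have hmono : (1 / 2 + 1 / (d : ℝ)) * Real.log ((d + 2) / (d - 2)) ≤
          p * Real.log ((d + 2) / (d - 2)) :=
        mul_le_mul_of_nonneg_right hp (Real.log_nonneg ((one_le_div hm).mpr (by linarith)))
      have l1 := Real.one_sub_inv_le_log_of_pos (div_pos hP hd0)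
      have l2 := Real.one_sub_inv_le_log_of_pos (div_pos hm hd0)
      have l1' := mul_le_mul_of_nonneg_left l1 (div_pos hP hd0).le
      have l2' := mul_le_mul_of_nonneg_left l2 (div_pos hm hd0).le
      have i1 : ((d : ℝ) + 2) / d * (1 - (((d : ℝ) + 2) / d)⁻¹) = 2 / d := by
        field_simp
        ring
      have i2 : ((d : ℝ) - 2) / d * (1 - (((d : ℝ) - 2) / d)⁻¹) = -(2 / d) := by
        field_simp
        ring
      rw [i1] at l1'
      rw [i2] at l2'
      have key : 0 ≤ Real.log ((d - 2) / d) + p * Real.log ((d + 2) / (d - 2)) := by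
        refine le_trans ?_ (add_le_add_right hmono _)
        have hsum := add_le_add l1' l2'
        rw [Real.log_div hP.ne' hd0.ne', Real.log_div hm.ne' hd0.ne'] at hsum
        rw [Real.log_div hm.ne' hd0.ne', Real.log_div hP.ne' hm.ne']
        field_simp at hsum ⊢
        linarith
      have : Real.logb 2 (((d : ℝ) - 2) / d) + p * Real.logb 2 ((d + 2) / (d - 2)) =
          (Real.log ((d - 2) / d) + p * Real.log ((d + 2) / (d - 2))) / Real.log 2 := by
        simp only [Real.logb]
        ring
      rw [this]
      exact div_nonneg key hl.le
end
end
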